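/- arXiv:2307.05712 — 4 statements merged into one kernel-verified Lean document; each statement's English description precedes it below -/
import Mathlib

section
/- Let Q ∈ ℚ[x,y] be a polynomial of total degree 2. Then either #ℛ_Q([N,2N]) ≪ N/√(log N), or the infimum of Q(x,y) over (x,y) ∈ ℤ² is −∞. In particular, there is no quadratic polynomial Q ∈ ℚ[x,y] with Q(ℤ²) = ℤ_{≥0}. -/
namespace QD
open Filter Topology
open scoped NumberTheorySymbols

/-- The Kronecker-type character `n ↦ (-d / n)` for odd `n`, zero at even `n`. -/
noncomputable def chi (d : ℕ) (n : ℕ) : ℤ := if Odd n then J(-(d : ℤ) | n) else 0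

lemma chi_mul (d m n : ℕ) : chi d (m * n) = chi d m * chi d n := by
  unfold chi
  by_cases hm : Odd m
  · by_cases hn : Odd n
    · have hm0 : m ≠ 0 := by rintro rfl; simp at hm
      have hn0 : n ≠ 0 := by rintro rfl; simp at hn
      simp [hm, hn, Nat.odd_mul, jacobiSym.mul_right' _ hm0 hn0]
    · simp [hn, Nat.odd_mul]
  · simp [hm, Nat.odd_mul]

lemma chi_one (d : ℕ) : chi d 1 = 1 := by simp [chi]
lemma chi_zero (d : ℕ) : chi d 0 = 0 := by simp [chi]

lemma chi_tri (d n : ℕ) : chi d n = 0 ∨ chi d n = 1 ∨ chi d n = -1 := by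
  unfold chi
  split_ifs
  · exact jacobiSym.trichotomy _ _
  · simp

lemma chi_mod (d n : ℕ) : chi d (n % (4 * d)) = chi d n := by
  unfold chi
  have h : Odd (n % (4 * d)) ↔ Odd n := by
    rw [Nat.odd_iff, Nat.odd_iff, Nat.mod_mod_of_dvd]
    exact ⟨2 * d, by ring⟩
  by_cases hn : Odd n
  · have := jacobiSym.mod_right (-(d : ℤ)) hn
    simp only [h, hn, if_true]
    rw [this]; simp
  · simp [h, hn]

lemma chi_dvd {d p : ℕ} (hd : 0 < d) (hp : p.Prime) (h : chi d p = 0) : p ∣ 4 * d := by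
  unfold chi at h
  split_ifs at h with ho
  · rw [jacobiSym.eq_zero_iff] at h
    have h2 := h.2
    have : ¬ Nat.Coprime d p := by simpa [Int.gcd] using h2
    rw [Nat.coprime_comm, hp.coprime_iff_not_dvd, not_not] at this
    exact this.mul_left 4
  · have : p = 2 := by
      rcases hp.eq_two_or_odd' with h | h
      · exact h
      · exact absurd h ho
    subst this
    exact ⟨2 * d, by ring⟩

lemma chi_coprime {d n : ℕ} (hd : 0 < d) (h : chi d n ≠ 0) : Nat.Coprime n (4 * d) := by
  unfold chi at h
  split_ifs at h with ho
  · have hn0 : n ≠ 0 := by rintro rfl; simp at ho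
    have : Nat.Coprime d n := by
      by_contra hc
      apply h
      rw [jacobiSym.eq_zero_iff]
      exact ⟨hn0, by simpa [Int.gcd] using hc⟩
    have h2 : Nat.Coprime n 4 := by
      have := (Nat.coprime_two_right (n := n)).2 ho
      exact Nat.Coprime.pow_right 2 this
    exact h2.mul_right this.symm
  · exact absurd rfl h

lemma chi_neg (d : ℕ) (hd : 0 < d) : chi d (4 * d - 1) = -1 := by
  have ho : Odd (4 * d - 1) := by rw [Nat.odd_iff]; omega
  unfold chi
  rw [if_pos ho]
  have h4 : J(4 | 4 * d - 1) = 1 := by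
    have : (4 : ℤ) = 2 ^ 2 := by norm_num
    rw [this]
    apply jacobiSym.sq_one'
    have := (Nat.coprime_two_left (n := 4 * d - 1)).2 ho
    simpa [Int.gcd] using this
  have h1 : J(4 * -(d : ℤ) | 4 * d - 1) = J(-1 | 4 * d - 1) := by
    apply jacobiSym.mod_left'
    apply Int.ModEq.symm
    rw [Int.modEq_iff_dvd]
    refine ⟨-1, ?_⟩
    push_cast [show 1 ≤ 4 * d by omega]
    ring
  rw [jacobiSym.mul_left, h4, one_mul, jacobiSym.at_neg_one ho,
    ZMod.χ₄_nat_three_mod_four (by omega)] at h1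
  exact h1

lemma exists_char (d : ℕ) (hd : 0 < d) :
    ∃ χ : DirichletCharacter ℂ (4 * d), χ ≠ 1 ∧ ∀ n : ℕ, χ n = (chi d n : ℂ) := by
  have : NeZero (4 * d) := ⟨by omega⟩
  have : Fact (1 < 4 * d) := ⟨by omega⟩
  let χ : DirichletCharacter ℂ (4 * d) :=
    { toFun := fun a => (chi d a.val : ℂ)
      map_one' := by rw [ZMod.val_one]; simp [chi_one]
      map_mul' := fun a b => by
        rw [ZMod.val_mul, chi_mod, chi_mul]; push_cast; rfl
      map_nonunit' := fun a ha => by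
        by_contra hc
        apply ha
        have h0 : chi d a.val ≠ 0 := by
          intro h; apply hc; simp [h]
        have := chi_coprime hd h0
        rw [← ZMod.isUnit_iff_coprime] at this
        simpa using this }
  have key : ∀ n : ℕ, χ n = (chi d n : ℂ) := by
    intro n
    change ((chi d (n : ZMod (4 * d)).val : ℤ) : ℂ) = _
    rw [ZMod.val_natCast, chi_mod]
  refine ⟨χ, ?_, key⟩
  intro h
  have h1 := key (4 * d - 1)
  rw [chi_neg d hd, h] at h1
  have hu : IsUnit (((4 * d - 1 : ℕ)) : ZMod (4 * d)) := by
    rw [ZMod.isUnit_iff_coprime]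
    apply chi_coprime hd
    rw [chi_neg d hd]; norm_num
  rw [MulChar.one_apply hu] at h1
  norm_num at h1

lemma summable_aux {σ : ℝ} (hσ : 1 < σ) (f : ℕ → ℝ) (hf : ∀ n, |f n| ≤ 1) :
    Summable (fun n : ℕ => ‖f n * (n : ℝ) ^ (-σ)‖) := by
  refine Summable.of_nonneg_of_le (fun _ => norm_nonneg _) (fun n => ?_)
    (Real.summable_nat_rpow.2 (by linarith : -σ < -1))
  rw [norm_mul, Real.norm_eq_abs, Real.norm_of_nonneg (by positivity)]
  exact mul_le_of_le_one_left (by positivity) (hf n)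

lemma chi_abs (d n : ℕ) : |((chi d n : ℤ) : ℝ)| ≤ 1 := by
  rcases chi_tri d n with h | h | h <;> simp [h]

lemma L_bound (d : ℕ) (hd : 0 < d) :
    ∃ C : ℝ, 0 < C ∧ ∀ σ : ℝ, 1 < σ → σ ≤ 2 →
      (∑' n : ℕ, (chi d n : ℝ) * (n : ℝ) ^ (-σ)) ≤ C := by
  have : NeZero (4 * d) := ⟨by omega⟩
  obtain ⟨χ, hχ, hn⟩ := exists_char d hd
  have hc : Continuous (fun σ : ℝ => ‖DirichletCharacter.LFunction χ (σ : ℂ)‖) :=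
    ((DirichletCharacter.differentiable_LFunction hχ).continuous.comp
      Complex.continuous_ofReal).norm
  obtain ⟨C, hC⟩ := (isCompact_Icc (a := (1 : ℝ)) (b := 2)).bddAbove_image hc.continuousOn
  refine ⟨max C 1, by positivity, fun σ h1 h2 => ?_⟩
  have hb : ‖DirichletCharacter.LFunction χ (σ : ℂ)‖ ≤ C :=
    hC ⟨σ, ⟨h1.le, h2⟩, rfl⟩
  rw [DirichletCharacter.LFunction_eq_LSeries χ (by simpa using h1)] at hb
  have : LSeries (fun n : ℕ => χ n) σ =
      ((∑' n : ℕ, (chi d n : ℝ) * (n : ℝ) ^ (-σ) : ℝ) : ℂ) := by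
    rw [LSeries, Complex.ofReal_tsum]
    congr 1
    ext n
    rw [LSeries.term_def]
    split_ifs with h0
    · subst h0; simp [chi_zero]
    · rw [hn]
      push_cast
      rw [Complex.ofReal_cpow (by positivity), Complex.ofReal_neg, Complex.cpow_neg]
      simp [div_eq_mul_inv]
  rw [this, Complex.norm_real] at hb
  exact (le_abs_self _).trans (hb.trans (le_max_left _ _))

lemma zeta_bound : ∃ δ : ℝ, 0 < δ ∧ ∀ σ : ℝ, 1 < σ → σ < 1 + δ →
      (∑' n : ℕ, (n : ℝ) ^ (-σ)) ≤ 2 / (σ - 1) := by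
  have h := tendsto_sub_mul_tsum_nat_rpow
  have h2 := h.eventually (eventually_le_nhds (show (1 : ℝ) < 2 by norm_num))
  rw [eventually_nhdsWithin_iff, Metric.eventually_nhds_iff] at h2
  obtain ⟨δ, hδ, h3⟩ := h2
  refine ⟨δ, hδ, fun σ h1 h2 => ?_⟩
  have := h3 (y := σ) (by rw [Real.dist_eq, abs_of_pos (by linarith)]; linarith) h1
  rw [le_div_iff₀ (by linarith), mul_comm]
  simpa [Real.rpow_neg, one_div] using this

/-- indicator of integers with no prime factor inert for `chi d` -/
noncomputable def hh (d : ℕ) : ℕ →*₀ ℝ := by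
  classical
  exact
  { toFun := fun n => if n ≠ 0 ∧ ∀ p, p.Prime → p ∣ n → chi d p ≠ -1 then 1 else 0
    map_zero' := by simp
    map_one' := by
      rw [if_pos]
      refine ⟨one_ne_zero, fun p hp h => ?_⟩
      exact absurd (Nat.dvd_one.1 h) hp.one_lt.ne'
    map_mul' := fun m n => by
      rw [ite_zero_mul_ite_zero, one_mul]
      refine if_congr ?_ rfl rfl
      constructor
      · rintro ⟨h0, h⟩
        exact ⟨⟨left_ne_zero_of_mul h0, fun p hp hd => h p hp (hd.mul_right _)⟩,
          ⟨right_ne_zero_of_mul h0, fun p hp hd => h p hp (hd.mul_left _)⟩⟩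
      · rintro ⟨⟨h0, h⟩, ⟨h0', h'⟩⟩
        refine ⟨mul_ne_zero h0 h0', fun p hp hd => ?_⟩
        rcases hp.dvd_mul.1 hd with h1 | h1
        · exact h p hp h1
        · exact h' p hp h1 }

open Classical in
lemma hh_apply (d n : ℕ) :
    hh d n = if n ≠ 0 ∧ ∀ p, p.Prime → p ∣ n → chi d p ≠ -1 then 1 else 0 := by
  simp only [hh]
  rfl

lemma hh_01 (d n : ℕ) : hh d n = 0 ∨ hh d n = 1 := by
  rw [hh_apply]; split_ifs <;> simp

lemma hh_nonneg (d n : ℕ) : 0 ≤ hh d n := by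
  rcases hh_01 d n with h | h <;> rw [h] <;> norm_num
lemma hh_le_one (d n : ℕ) : hh d n ≤ 1 := by
  rcases hh_01 d n with h | h <;> rw [h] <;> norm_num

lemma hh_prime {d p : ℕ} (hp : p.Prime) : hh d p = if chi d p = -1 then 0 else 1 := by
  rw [hh_apply]
  by_cases h : chi d p = -1
  · rw [if_neg, if_pos h]
    rintro ⟨-, h'⟩
    exact h' p hp dvd_rfl h
  · rw [if_pos, if_neg h]
    refine ⟨hp.ne_zero, fun q hq hqp => ?_⟩
    rwa [(Nat.prime_dvd_prime_iff_eq hq hp).1 hqp]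

/-- twist by `n ^ (-σ)` -/
noncomputable def twist (f : ℕ →*₀ ℝ) (σ : ℝ) : ℕ →*₀ ℝ where
  toFun n := f n * (n : ℝ) ^ (-σ)
  map_zero' := by simp
  map_one' := by simp
  map_mul' m n := by
    rw [map_mul, Nat.cast_mul, Real.mul_rpow (by positivity) (by positivity)]; ring

lemma twist_apply (f : ℕ →*₀ ℝ) (σ : ℝ) (n : ℕ) : twist f σ n = f n * (n : ℝ) ^ (-σ) := rfl

noncomputable def chiHom (d : ℕ) : ℕ →*₀ ℝ where
  toFun n := (chi d n : ℝ)
  map_zero' := by simp [chi_zero]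
  map_one' := by simp [chi_one]
  map_mul' m n := by rw [chi_mul]; push_cast; rfl

lemma chiHom_apply (d n : ℕ) : chiHom d n = (chi d n : ℝ) := rfl

open Classical in
noncomputable def oneHom : ℕ →*₀ ℝ where
  toFun n := if n = 0 then 0 else 1
  map_zero' := by simp
  map_one' := by simp
  map_mul' m n := by
    by_cases h : m = 0 <;> by_cases h' : n = 0 <;> simp [h, h']

lemma oneHom_apply (n : ℕ) : oneHom n = if n = 0 then (0 : ℝ) else 1 := by
  simp [oneHom]

lemma euler_le (d : ℕ) (hd : 0 < d) : ∃ C : ℝ, 0 < C ∧ ∀ σ : ℝ, 1 < σ →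
    (∑' n : ℕ, hh d n * (n : ℝ) ^ (-σ)) ^ 2 ≤
      C * ((∑' n : ℕ, (n : ℝ) ^ (-σ)) * (∑' n : ℕ, (chi d n : ℝ) * (n : ℝ) ^ (-σ))) := by
  classical
  have hp1 : ∀ p : ℕ, p.Prime → (1 : ℝ) ≤ (1 - (p : ℝ)⁻¹)⁻¹ := by
    intro p hp
    have : (2 : ℝ) ≤ p := by exact_mod_cast hp.two_le
    have h1 : (p : ℝ)⁻¹ < 1 := inv_lt_one_of_one_lt₀ (by linarith)
    have h2 : 0 < (p : ℝ)⁻¹ := by positivity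
    exact one_le_inv_iff₀.2 ⟨by linarith, by linarith⟩
  set C : ℝ := ∏ p ∈ (4 * d).primeFactors, (1 - (p : ℝ)⁻¹)⁻¹ with hC
  have hC0 : 0 < C := Finset.prod_pos fun p hp =>
    lt_of_lt_of_le one_pos (hp1 p (Nat.prime_of_mem_primeFactors hp))
  refine ⟨C, hC0, fun σ hσ => ?_⟩
  have e1 := EulerProduct.eulerProduct_completely_multiplicative (f := twist (hh d) σ)
    (summable_aux hσ _ fun n => by rw [abs_of_nonneg (hh_nonneg d n)]; exact hh_le_one d n)
  have e2 := EulerProduct.eulerProduct_completely_multiplicative (f := twist (chiHom d) σ)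
    (summable_aux hσ _ fun n => chi_abs d n)
  have e3 := EulerProduct.eulerProduct_completely_multiplicative (f := twist oneHom σ)
    (summable_aux hσ _ fun n => by rw [oneHom_apply]; split_ifs <;> simp)
  have e3' : ∑' n : ℕ, (twist oneHom σ n) = ∑' n : ℕ, (n : ℝ) ^ (-σ) := by
    congr 1
    ext n
    rw [twist_apply, oneHom_apply]
    split_ifs with h
    · subst h
      simp [Real.zero_rpow (show -σ ≠ 0 by linarith)]
    · simp
  rw [e3'] at e3
  refine le_of_tendsto_of_tendsto' (e1.pow 2) ((e3.mul e2).const_mul C) fun n => ?_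
  have hfac : ∀ p ∈ Nat.primesBelow n,
      0 ≤ (1 - twist (hh d) σ p)⁻¹ ^ 2 ∧ (1 - twist (hh d) σ p)⁻¹ ^ 2 ≤
      (if p ∈ (4 * d).primeFactors then (1 - (p : ℝ)⁻¹)⁻¹ else 1) *
        ((1 - twist oneHom σ p)⁻¹ * (1 - twist (chiHom d) σ p)⁻¹) := by
    intro p hp
    have hp := Nat.prime_of_mem_primesBelow hp
    refine ⟨by positivity, ?_⟩
    have h2 : (2 : ℝ) ≤ p := by exact_mod_cast hp.two_le
    simp only [twist_apply, chiHom_apply, oneHom_apply, if_neg hp.ne_zero, hh_prime hp]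
    set t : ℝ := (p : ℝ) ^ (-σ) with ht
    have ht0 : 0 < t := by positivity
    have ht1 : t ≤ (p : ℝ)⁻¹ := by
      rw [ht, ← Real.rpow_neg_one]
      exact Real.rpow_le_rpow_of_exponent_le (by linarith) (by linarith)
    have hpi : (p : ℝ)⁻¹ < 1 := inv_lt_one_of_one_lt₀ (by linarith)
    have hc1 : (1 : ℝ) ≤ (if p ∈ (4 * d).primeFactors then (1 - (p : ℝ)⁻¹)⁻¹ else 1) := by
      split_ifs
      · exact hp1 p hp
      · exact le_rfl
    rcases chi_tri d p with h | h | h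
    · have hm : p ∈ (4 * d).primeFactors :=
        Nat.mem_primeFactors.2 ⟨hp, chi_dvd hd hp h, by omega⟩
      rw [if_pos hm]
      simp only [h]
      norm_num
      rw [sq, mul_inv]
      apply mul_le_mul_of_nonneg_right
      · apply inv_anti₀ <;> linarith
      · rw [inv_nonneg]; linarith
    · simp only [h]
      generalize (if p ∈ (4 * d).primeFactors then (1 - (p : ℝ)⁻¹)⁻¹ else 1) = c at hc1 ⊢
      norm_num
      rw [sq, mul_inv]
      apply le_mul_of_one_le_left _ hc1
      apply mul_self_nonneg
    · simp only [h]
      generalize (if p ∈ (4 * d).primeFactors then (1 - (p : ℝ)⁻¹)⁻¹ else 1) = c at hc1 ⊢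
      norm_num
      have : 1 ≤ (1 - t)⁻¹ * (1 + t)⁻¹ := by
        rw [← mul_inv]
        apply one_le_inv_iff₀.2
        constructor
        · apply mul_pos <;> linarith
        · nlinarith
      have h5 := mul_le_mul hc1 this (by norm_num) (by linarith)
      simpa using h5
  calc (∏ p ∈ Nat.primesBelow n, (1 - twist (hh d) σ p)⁻¹) ^ 2
      = ∏ p ∈ Nat.primesBelow n, (1 - twist (hh d) σ p)⁻¹ ^ 2 := by rw [Finset.prod_pow]
    _ ≤ ∏ p ∈ Nat.primesBelow n,
        ((if p ∈ (4 * d).primeFactors then (1 - (p : ℝ)⁻¹)⁻¹ else 1) *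
        ((1 - twist oneHom σ p)⁻¹ * (1 - twist (chiHom d) σ p)⁻¹)) :=
        Finset.prod_le_prod (fun p hp => (hfac p hp).1) (fun p hp => (hfac p hp).2)
    _ = (∏ p ∈ Nat.primesBelow n,
        (if p ∈ (4 * d).primeFactors then (1 - (p : ℝ)⁻¹)⁻¹ else 1)) *
        ((∏ p ∈ Nat.primesBelow n, (1 - twist oneHom σ p)⁻¹) *
          ∏ p ∈ Nat.primesBelow n, (1 - twist (chiHom d) σ p)⁻¹) := by
        rw [Finset.prod_mul_distrib, Finset.prod_mul_distrib]
    _ ≤ _ := by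
        apply mul_le_mul_of_nonneg_right
        · rw [← Finset.prod_filter, hC]
          apply Finset.prod_le_prod_of_subset_of_one_le
          · intro p hp
            exact (Finset.mem_filter.1 hp).2
          · intro p hp
            exact le_trans zero_le_one (hp1 p (Nat.prime_of_mem_primeFactors (Finset.mem_filter.1 hp).2))
          · intro p hp _
            exact hp1 p (Nat.prime_of_mem_primeFactors hp)
        · rw [← Finset.prod_mul_distrib]
          apply Finset.prod_nonneg
          intro p hp
          have hp := Nat.prime_of_mem_primesBelow hp
          have h2 : (2 : ℝ) ≤ p := by exact_mod_cast hp.two_le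
          have ht0 : 0 < (p : ℝ) ^ (-σ) := by positivity
          have ht1 : (p : ℝ) ^ (-σ) ≤ (p : ℝ)⁻¹ := by
            rw [← Real.rpow_neg_one]
            exact Real.rpow_le_rpow_of_exponent_le (by linarith) (by linarith)
          have hpi : (p : ℝ)⁻¹ < 1 := inv_lt_one_of_one_lt₀ (by linarith)
          simp only [twist_apply, chiHom_apply, oneHom_apply, if_neg hp.ne_zero]
          rcases chi_tri d p with h | h | h <;> simp only [h] <;> norm_num <;> 
            first
            | linarith
            | (apply mul_nonneg <;> rw [inv_nonneg] <;> linarith)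

end QD

namespace QD
open Filter Topology

lemma H_bound (d : ℕ) (hd : 0 < d) : ∃ C δ : ℝ, 0 < C ∧ 0 < δ ∧ ∀ σ : ℝ, 1 < σ → σ < 1 + δ →
    (∑' n : ℕ, hh d n * (n : ℝ) ^ (-σ)) ≤ C / √(σ - 1) := by
  obtain ⟨C1, hC1, h1⟩ := euler_le d hd
  obtain ⟨C2, hC2, h2⟩ := L_bound d hd
  obtain ⟨δ, hδ, h3⟩ := zeta_bound
  refine ⟨√(C1 * (2 * C2)), min δ 1, by positivity, by positivity, fun σ hσ hσ2 => ?_⟩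
  have hσ3 : σ < 1 + δ := lt_of_lt_of_le hσ2 (by gcongr; exact min_le_left _ _)
  have hσ4 : σ ≤ 2 := by
    have := min_le_right δ 1
    linarith
  rw [← Real.sqrt_div' _ (by linarith)]
  apply Real.le_sqrt_of_sq_le
  refine (h1 σ hσ).trans ?_
  have hz := h3 σ hσ hσ3
  have hz0 : 0 ≤ ∑' n : ℕ, (n : ℝ) ^ (-σ) := tsum_nonneg fun n => by positivity
  have hL := h2 σ hσ hσ4
  calc C1 * ((∑' n : ℕ, (n : ℝ) ^ (-σ)) * (∑' n : ℕ, (chi d n : ℝ) * (n : ℝ) ^ (-σ)))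
      ≤ C1 * ((∑' n : ℕ, (n : ℝ) ^ (-σ)) * C2) := by gcongr
    _ ≤ C1 * ((2 / (σ - 1)) * C2) := by gcongr
    _ = C1 * (2 * C2) / (σ - 1) := by ring

lemma sum_div_bound (d : ℕ) (hd : 0 < d) : ∃ C : ℝ, 0 < C ∧ ∀ᶠ N : ℕ in atTop,
    ∑ m ∈ Finset.Ioc 0 N, hh d m / m ≤ C * √(Real.log N) := by
  obtain ⟨C, δ, hC, hδ, h⟩ := H_bound d hd
  refine ⟨Real.exp 1 * C, by positivity, ?_⟩
  have ht : Tendsto (fun N : ℕ => Real.log N) atTop atTop :=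
    Real.tendsto_log_atTop.comp tendsto_natCast_atTop_atTop
  filter_upwards [ht.eventually_gt_atTop (1 / δ), ht.eventually_gt_atTop 0,
    eventually_gt_atTop 0] with N hN1 hN0 hNpos
  set σ : ℝ := 1 + 1 / Real.log N with hσ
  have hσ1 : 1 < σ := by rw [hσ]; have : 0 < 1 / Real.log N := by positivity
                         linarith
  have hσ2 : σ < 1 + δ := by
    rw [hσ]
    have : 1 / Real.log N < δ := by
      rw [div_lt_iff₀ hN0]
      rw [div_lt_iff₀ hδ] at hN1
      linarith
    linarith
  have hb := h σ hσ1 hσ2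
  have hs : √(σ - 1) = 1 / √(Real.log N) := by
    rw [hσ]; simp
  rw [hs, div_div_eq_mul_div, div_one] at hb
  have hsum : Summable (fun n : ℕ => hh d n * (n : ℝ) ^ (-σ)) :=
    (summable_aux hσ1 _ fun n => by
      rw [abs_of_nonneg (hh_nonneg d n)]; exact hh_le_one d n).of_norm
  calc ∑ m ∈ Finset.Ioc 0 N, hh d m / m
      ≤ ∑ m ∈ Finset.Ioc 0 N, Real.exp 1 * (hh d m * (m : ℝ) ^ (-σ)) := by
        apply Finset.sum_le_sum
        intro m hm
        rw [Finset.mem_Ioc] at hm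
        have hm0 : (0 : ℝ) < m := by exact_mod_cast hm.1
        have hmN : (m : ℝ) ≤ N := by exact_mod_cast hm.2
        have : (m : ℝ)⁻¹ ≤ Real.exp 1 * (m : ℝ) ^ (-σ) := by
          rw [Real.rpow_def_of_pos hm0, ← Real.exp_add, ← Real.exp_log hm0, ← Real.exp_neg,
            Real.log_exp]
          apply Real.exp_le_exp.2
          have hl : Real.log m ≤ Real.log N := Real.log_le_log hm0 hmN
          have : Real.log m / Real.log N ≤ 1 := by rw [div_le_one hN0]; exact hl
          have e : Real.log m * -σ = - Real.log m - Real.log m / Real.log N := by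
            rw [hσ]; ring
          rw [e]; linarith
        calc hh d m / m = hh d m * (m : ℝ)⁻¹ := by rw [div_eq_mul_inv]
          _ ≤ hh d m * (Real.exp 1 * (m : ℝ) ^ (-σ)) :=
            mul_le_mul_of_nonneg_left this (hh_nonneg d m)
          _ = _ := by ring
    _ = Real.exp 1 * ∑ m ∈ Finset.Ioc 0 N, (hh d m * (m : ℝ) ^ (-σ)) := by
        rw [Finset.mul_sum]
    _ ≤ Real.exp 1 * ∑' m : ℕ, (hh d m * (m : ℝ) ^ (-σ)) := by
        gcongr
        exact hsum.sum_le_tsum _ fun n _ => mul_nonneg (hh_nonneg d n) (by positivity)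
    _ ≤ Real.exp 1 * (C * √(Real.log N)) := by gcongr
    _ = _ := by ring

noncomputable def hhA (d : ℕ) : ArithmeticFunction ℝ := ⟨fun n => hh d n, by simp⟩
noncomputable def hhL (d : ℕ) : ArithmeticFunction ℝ :=
  ⟨fun n => hh d n * ArithmeticFunction.vonMangoldt n, by simp⟩

lemma conv_apply (d n : ℕ) : (hhA d * hhL d) n = hh d n * Real.log n := by
  rw [ArithmeticFunction.mul_apply, ← ArithmeticFunction.vonMangoldt_sum,
    ← Nat.map_div_left_divisors, Finset.sum_map, Finset.mul_sum]
  apply Finset.sum_congr rfl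
  intro b hb
  have hb := Nat.dvd_of_mem_divisors hb
  change hh d (n / b) * (hh d b * ArithmeticFunction.vonMangoldt b) = _
  rw [← mul_assoc, ← map_mul, Nat.div_mul_cancel hb]

lemma T_log (d N : ℕ) :
    (∑ m ∈ Finset.Ioc 0 N, hh d m) * Real.log N ≤
      (Real.log 4 + 5) * N * ∑ m ∈ Finset.Ioc 0 N, hh d m / m := by
  have h1 : ∑ m ∈ Finset.Ioc 0 N, hh d m * Real.log m ≤
      (Real.log 4 + 4) * N * ∑ m ∈ Finset.Ioc 0 N, hh d m / m := by
    calc ∑ m ∈ Finset.Ioc 0 N, hh d m * Real.log m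
        = ∑ m ∈ Finset.Ioc 0 N, (hhA d * hhL d) m := by simp only [conv_apply]
      _ = ∑ n ∈ Finset.Ioc 0 N, hhA d n * ∑ m ∈ Finset.Ioc 0 (N / n), hhL d m :=
          ArithmeticFunction.sum_Ioc_mul_eq_sum_sum _ _ _
      _ ≤ ∑ n ∈ Finset.Ioc 0 N, hh d n * ((Real.log 4 + 4) * (N / n)) := by
          apply Finset.sum_le_sum
          intro n hn
          apply mul_le_mul_of_nonneg_left _ (hh_nonneg d n)
          have hp := Chebyshev.psi_le_const_mul_self (x := (N : ℝ) / n) (by positivity)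
          refine le_trans ?_ hp
          rw [Chebyshev.psi, Nat.floor_div_eq_div]
          apply Finset.sum_le_sum
          intro m _
          exact mul_le_of_le_one_left ArithmeticFunction.vonMangoldt_nonneg (hh_le_one d m)
      _ = _ := by
          rw [Finset.mul_sum]
          apply Finset.sum_congr rfl
          intro n _
          ring
  have h2 : ∑ m ∈ Finset.Ioc 0 N, hh d m * (Real.log N - Real.log m) ≤
      N * ∑ m ∈ Finset.Ioc 0 N, hh d m / m := by
    rw [Finset.mul_sum]
    apply Finset.sum_le_sum
    intro m hm
    rw [Finset.mem_Ioc] at hm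
    have hm0 : (0 : ℝ) < m := by exact_mod_cast hm.1
    have hN0 : (0 : ℝ) < N := by exact_mod_cast (lt_of_lt_of_le hm.1 hm.2)
    rw [← Real.log_div hN0.ne' hm0.ne']
    have := Real.log_le_sub_one_of_pos (show (0 : ℝ) < N / m by positivity)
    calc hh d m * Real.log (N / m) ≤ hh d m * (N / m) :=
          mul_le_mul_of_nonneg_left (by linarith) (hh_nonneg d m)
      _ = _ := by ring
  have h3 : (∑ m ∈ Finset.Ioc 0 N, hh d m) * Real.log N =
      ∑ m ∈ Finset.Ioc 0 N, hh d m * Real.log m +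
      ∑ m ∈ Finset.Ioc 0 N, hh d m * (Real.log N - Real.log m) := by
    rw [← Finset.sum_add_distrib, Finset.sum_mul]
    apply Finset.sum_congr rfl
    intro m _
    ring
  rw [h3]
  linarith

lemma T_le (d N : ℕ) : ∑ m ∈ Finset.Ioc 0 N, hh d m ≤ N := by
  calc ∑ m ∈ Finset.Ioc 0 N, hh d m ≤ ∑ m ∈ Finset.Ioc 0 N, (1 : ℝ) :=
        Finset.sum_le_sum fun m _ => hh_le_one d m
    _ = N := by simp

lemma T_bound (d : ℕ) (hd : 0 < d) : ∃ C : ℝ, 0 < C ∧ ∀ N : ℕ, 0 < N →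
    (∑ m ∈ Finset.Ioc 0 N, hh d m) * √(1 + Real.log N) ≤ C * N := by
  obtain ⟨C, hC, h⟩ := sum_div_bound d hd
  have ht : Tendsto (fun N : ℕ => Real.log N) atTop atTop :=
    Real.tendsto_log_atTop.comp tendsto_natCast_atTop_atTop
  obtain ⟨N0, h0⟩ := eventually_atTop.1 (h.and (ht.eventually_ge_atTop 1))
  have hl4 : 0 < Real.log 4 := Real.log_pos (by norm_num)
  refine ⟨max (√2 * ((Real.log 4 + 5) * C)) (√(1 + Real.log N0)), by positivity,
    fun N hN => ?_⟩
  have hN' : (0 : ℝ) < N := by exact_mod_cast hN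
  have hT0 : 0 ≤ ∑ m ∈ Finset.Ioc 0 N, hh d m := Finset.sum_nonneg fun m _ => hh_nonneg d m
  rcases le_total N0 N with hle | hle
  · obtain ⟨ha, hb⟩ := h0 N hle
    have hL : 0 < √(Real.log N) := Real.sqrt_pos.2 (by linarith)
    have hLs : √(Real.log N) * √(Real.log N) = Real.log N := Real.mul_self_sqrt (by linarith)
    have h3 : (∑ m ∈ Finset.Ioc 0 N, hh d m) * √(Real.log N) ≤ (Real.log 4 + 5) * C * N := by
      have h4 : (∑ m ∈ Finset.Ioc 0 N, hh d m) * Real.log N ≤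
          (Real.log 4 + 5) * N * (C * √(Real.log N)) :=
        (T_log d N).trans (by gcongr)
      rw [← hLs] at h4
      have h5 : ((∑ m ∈ Finset.Ioc 0 N, hh d m) * √(Real.log N)) * √(Real.log N) ≤
          ((Real.log 4 + 5) * C * N) * √(Real.log N) := by
        rw [Real.sqrt_mul_self hL.le] at h4
        linarith
      exact le_of_mul_le_mul_right h5 hL
    have h6 : √(1 + Real.log N) ≤ √2 * √(Real.log N) := by
      rw [← Real.sqrt_mul (by norm_num)]
      apply Real.sqrt_le_sqrt
      linarith
    calc _ ≤ (∑ m ∈ Finset.Ioc 0 N, hh d m) * (√2 * √(Real.log N)) := by gcongr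
      _ = √2 * ((∑ m ∈ Finset.Ioc 0 N, hh d m) * √(Real.log N)) := by ring
      _ ≤ √2 * ((Real.log 4 + 5) * C * N) := by gcongr
      _ = √2 * ((Real.log 4 + 5) * C) * N := by ring
      _ ≤ _ := by gcongr; exact le_max_left _ _
  · calc _ ≤ (N : ℝ) * √(1 + Real.log N0) := by
          gcongr
          exact T_le d N
      _ = √(1 + Real.log N0) * N := by ring
      _ ≤ _ := by gcongr; exact le_max_right _ _

/-- numbers of the form `m k²` with `m` free of inert primes -/
def S (d : ℕ) : Set ℕ := {n | ∃ m k : ℕ, 0 < k ∧ hh d m = 1 ∧ n = m * k ^ 2}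

open Classical in
lemma S_count (d : ℕ) (hd : 0 < d) : ∃ C : ℝ, 0 < C ∧ ∀ N : ℕ, 0 < N →
    (((Finset.Ioc 0 N).filter (· ∈ S d)).card : ℝ) * √(1 + Real.log N) ≤ C * N := by
  obtain ⟨C, hC, h⟩ := T_bound d hd
  have hsm : Summable (fun k : ℕ => (k : ℝ) ^ (-(3 / 2 : ℝ))) :=
    Real.summable_nat_rpow.2 (by norm_num)
  refine ⟨C * √2 * (∑' k : ℕ, (k : ℝ) ^ (-(3 / 2 : ℝ)) + 1), ?_, fun N hN => ?_⟩
  · have : 0 ≤ ∑' k : ℕ, (k : ℝ) ^ (-(3 / 2 : ℝ)) := tsum_nonneg fun k => by positivity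
    positivity
  have hN' : (0 : ℝ) < N := by exact_mod_cast hN
  have hsub : (Finset.Ioc 0 N).filter (· ∈ S d) ⊆
      (Finset.Ioc 0 N).biUnion fun k =>
        ((Finset.Ioc 0 (N / k ^ 2)).filter (fun m => hh d m = 1)).image (fun m => m * k ^ 2) := by
    intro n hn
    rw [Finset.mem_filter, Finset.mem_Ioc] at hn
    obtain ⟨⟨hn0, hnN⟩, m, k, hk, hm, rfl⟩ := hn
    have hm0 : 0 < m := Nat.pos_of_mul_pos_right hn0
    rw [Finset.mem_biUnion]
    refine ⟨k, ?_, ?_⟩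
    · rw [Finset.mem_Ioc]
      refine ⟨hk, le_trans ?_ hnN⟩
      nlinarith
    · rw [Finset.mem_image]
      refine ⟨m, ?_, rfl⟩
      rw [Finset.mem_filter, Finset.mem_Ioc]
      refine ⟨⟨hm0, ?_⟩, hm⟩
      rw [Nat.le_div_iff_mul_le (by positivity)]
      exact hnN
  have hcard : (((Finset.Ioc 0 N).filter (· ∈ S d)).card : ℝ) ≤
      ∑ k ∈ Finset.Ioc 0 N, ∑ m ∈ Finset.Ioc 0 (N / k ^ 2), hh d m := by
    calc (((Finset.Ioc 0 N).filter (· ∈ S d)).card : ℝ)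
        ≤ ((∑ k ∈ Finset.Ioc 0 N,
          ((Finset.Ioc 0 (N / k ^ 2)).filter (fun m => hh d m = 1)).card : ℕ) : ℝ) := by
          have := (Finset.card_le_card hsub).trans (Finset.card_biUnion_le.trans
            (Finset.sum_le_sum fun k _ => Finset.card_image_le))
          exact_mod_cast this
      _ ≤ _ := by
          push_cast
          apply Finset.sum_le_sum
          intro k _
          rw [Finset.card_filter]
          push_cast
          apply Finset.sum_le_sum
          intro m _
          split_ifs with h1
          · rw [h1]
          · exact hh_nonneg d m
  have hterm : ∀ k ∈ Finset.Ioc 0 N,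
      (∑ m ∈ Finset.Ioc 0 (N / k ^ 2), hh d m) * √(1 + Real.log N) ≤
        C * √2 * N * (k : ℝ) ^ (-(3 / 2 : ℝ)) := by
    intro k hk
    rw [Finset.mem_Ioc] at hk
    have hk0 : (0 : ℝ) < k := by exact_mod_cast hk.1
    have hk1 : (1 : ℝ) ≤ k := by exact_mod_cast hk.1
    rcases Nat.eq_zero_or_pos (N / k ^ 2) with h0 | hpos
    · rw [h0]; simp; positivity
    · set M := N / k ^ 2 with hM
      have hM1 : (1 : ℝ) ≤ M := by exact_mod_cast hpos
      have hMle : (M : ℝ) ≤ N / k ^ 2 := by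
        rw [hM]; exact_mod_cast (Nat.cast_div_le (α := ℝ) (m := N) (n := k ^ 2))
      have hlt : (N : ℝ) ≤ 2 * M * k ^ 2 := by
        have h1 : N < (M + 1) * k ^ 2 := by
          rw [hM, mul_comm]
          exact Nat.lt_mul_div_succ N (by have := hk.1; positivity)
        have h2 : N ≤ 2 * M * k ^ 2 := by nlinarith
        exact_mod_cast h2
      have hlog : Real.log N ≤ Real.log 2 + Real.log M + 2 * Real.log k := by
        have := Real.log_le_log hN' hlt
        rw [Real.log_mul (by positivity) (by positivity), Real.log_mul (by norm_num)
          (by positivity), Real.log_pow] at this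
        exact_mod_cast this
      have hlM : 0 ≤ Real.log M := Real.log_nonneg hM1
      have hl2 : Real.log 2 ≤ 1 := by
        have := Real.log_le_sub_one_of_pos (show (0 : ℝ) < 2 by norm_num); linarith
      have hlk : Real.log k ≤ k - 1 := Real.log_le_sub_one_of_pos hk0
      have hlk0 : 0 ≤ Real.log k := Real.log_nonneg hk1
      have hsq : √(1 + Real.log N) ≤ √(1 + Real.log M) * (√2 * √k) := by
        rw [← Real.sqrt_mul (by norm_num), ← Real.sqrt_mul (by linarith)]
        apply Real.sqrt_le_sqrt
        nlinarith
      have hT := h M hpos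
      have hT0 : 0 ≤ ∑ m ∈ Finset.Ioc 0 M, hh d m :=
        Finset.sum_nonneg fun m _ => hh_nonneg d m
      have hkp : (k : ℝ) ^ (-(3 / 2 : ℝ)) = √k / k ^ 2 := by
        rw [Real.sqrt_eq_rpow, ← Real.rpow_natCast, ← Real.rpow_sub hk0]
        norm_num
      calc (∑ m ∈ Finset.Ioc 0 M, hh d m) * √(1 + Real.log N)
          ≤ (∑ m ∈ Finset.Ioc 0 M, hh d m) * (√(1 + Real.log M) * (√2 * √k)) := by gcongr
        _ = ((∑ m ∈ Finset.Ioc 0 M, hh d m) * √(1 + Real.log M)) * (√2 * √k) := by ring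
        _ ≤ (C * M) * (√2 * √k) := by gcongr
        _ ≤ (C * (N / k ^ 2)) * (√2 * √k) := by gcongr
        _ = _ := by rw [hkp]; ring
  calc (((Finset.Ioc 0 N).filter (· ∈ S d)).card : ℝ) * √(1 + Real.log N)
      ≤ (∑ k ∈ Finset.Ioc 0 N, ∑ m ∈ Finset.Ioc 0 (N / k ^ 2), hh d m) * √(1 + Real.log N) := by
        gcongr
    _ ≤ ∑ k ∈ Finset.Ioc 0 N, C * √2 * N * (k : ℝ) ^ (-(3 / 2 : ℝ)) := by
        rw [Finset.sum_mul]
        exact Finset.sum_le_sum hterm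
    _ = C * √2 * N * ∑ k ∈ Finset.Ioc 0 N, (k : ℝ) ^ (-(3 / 2 : ℝ)) := by rw [Finset.mul_sum]
    _ ≤ C * √2 * N * (∑' k : ℕ, (k : ℝ) ^ (-(3 / 2 : ℝ)) + 1) := by
        gcongr
        have := hsm.sum_le_tsum (Finset.Ioc 0 N) fun n _ => by positivity
        linarith
    _ = _ := by ring

lemma mem_S (d : ℕ) (n : ℕ) : 0 < n → ∀ x y : ℤ, (n : ℤ) = x ^ 2 + d * y ^ 2 → n ∈ S d := by
  induction n using Nat.strong_induction_on with
  | _ n ih =>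
    intro hn x y hxy
    by_cases hex : ∃ p, p.Prime ∧ p ∣ n ∧ chi d p = -1
    · obtain ⟨p, hp, hpn, hchi⟩ := hex
      have : Fact p.Prime := ⟨hp⟩
      have hJ : jacobiSym (-(d : ℤ)) p = -1 := by
        unfold chi at hchi
        split_ifs at hchi
        · exact hchi
      have hdv : (p : ℤ) ∣ x ^ 2 - (-(d : ℤ)) * y ^ 2 := by
        have : x ^ 2 - (-(d : ℤ)) * y ^ 2 = n := by rw [hxy]; ring
        rw [this]; exact_mod_cast hpn
      obtain ⟨⟨x', hx'⟩, ⟨y', hy'⟩⟩ := jacobiSym.prime_dvd_of_eq_neg_one hJ hdv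
      have hn2 : (n : ℤ) = (p : ℤ) ^ 2 * (x' ^ 2 + d * y' ^ 2) := by
        rw [hxy, hx', hy']; ring
      have hdiv : p ^ 2 ∣ n := by
        have : ((p ^ 2 : ℕ) : ℤ) ∣ n := ⟨_, by rw [hn2]; push_cast; rfl⟩
        exact_mod_cast this
      obtain ⟨n', rfl⟩ := hdiv
      have hp2 := hp.two_le
      have hn'0 : 0 < n' := Nat.pos_of_mul_pos_left hn
      have hn' : (n' : ℤ) = x' ^ 2 + d * y' ^ 2 := by
        push_cast at hn2
        exact mul_left_cancel₀ (by positivity) hn2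
      have h4 : 4 ≤ p ^ 2 := by nlinarith
      have hlt : n' < p ^ 2 * n' := by nlinarith
      obtain ⟨m, k, hk, hm, he⟩ := ih n' hlt hn'0 x' y' hn'
      exact ⟨m, p * k, by positivity, hm, by rw [he]; ring⟩
    · push Not at hex
      refine ⟨n, 1, one_pos, ?_, by ring⟩
      rw [hh_apply, if_pos ⟨hn.ne', hex⟩]

end QD

namespace QD
open Filter Topology

lemma rep_count (A : ℕ) (hA : 0 < A) (B : ℤ) (D : ℕ) (hD : 0 < D) (R : Set ℚ)
    (hR : ∀ q ∈ R, ∃ v u : ℤ, (A : ℚ) * q + B = ((v ^ 2 + D * u ^ 2 : ℤ) : ℚ)) :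
    ∃ c : ℝ, 0 < c ∧ ∀ᶠ N : ℕ in atTop,
      ({q : ℚ | (N : ℚ) ≤ q ∧ q ≤ 2 * N ∧ q ∈ R}.ncard : ℝ) ≤ c * N / √(Real.log N) := by
  classical
  obtain ⟨C, hC, h⟩ := S_count D hD
  refine ⟨C * (3 * A), by positivity, ?_⟩
  filter_upwards [eventually_gt_atTop (B.natAbs + 1)] with N hN
  have hN1 : 1 < N := by omega
  have hN' : (1 : ℝ) < N := by exact_mod_cast hN1
  have hlog : 0 < Real.log N := Real.log_pos hN'
  set F := (Finset.Ioc 0 (3 * A * N)).filter (· ∈ S D) with hF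
  have hcard : {q : ℚ | (N : ℚ) ≤ q ∧ q ≤ 2 * N ∧ q ∈ R}.ncard ≤ F.card := by
    rw [← Set.ncard_coe_finset F]
    refine Set.ncard_le_ncard_of_injOn (fun q : ℚ => ((A : ℚ) * q + B).num.toNat) ?_ ?_
      F.finite_toSet
    · rintro q ⟨h1, h2, h3⟩
      obtain ⟨v, u, hvu⟩ := hR q h3
      simp only [hvu, Rat.num_intCast]
      set w : ℤ := v ^ 2 + D * u ^ 2 with hw
      have hA1 : (1 : ℚ) ≤ A := by exact_mod_cast hA
      have hB1 : (B : ℚ) < N := by exact_mod_cast (by omega : B < (N : ℤ))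
      have hB2 : -(N : ℚ) < B := by exact_mod_cast (by omega : -(N : ℤ) < B)
      have hw0 : 0 < w := by
        have : (0 : ℚ) < w := by rw [← hvu]; nlinarith
        exact_mod_cast this
      have hw1 : w ≤ 3 * A * N := by
        have : (w : ℚ) ≤ 3 * A * N := by rw [← hvu]; nlinarith
        exact_mod_cast this
      rw [hF, Finset.mem_coe, Finset.mem_filter, Finset.mem_Ioc]
      refine ⟨⟨by omega, ?_⟩, ?_⟩
      · rw [Int.toNat_le]; exact_mod_cast hw1
      · apply mem_S D _ (by omega) v u
        rw [Int.toNat_of_nonneg hw0.le]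
    · rintro q ⟨h1, h2, h3⟩ q' ⟨h1', h2', h3'⟩ he
      obtain ⟨v, u, hvu⟩ := hR q h3
      obtain ⟨v', u', hvu'⟩ := hR q' h3'
      simp only [hvu, hvu', Rat.num_intCast] at he
      have e1 : v ^ 2 + D * u ^ 2 = v' ^ 2 + D * u' ^ 2 := by
        have a1 : 0 ≤ v ^ 2 + D * u ^ 2 := by positivity
        have a2 : 0 ≤ v' ^ 2 + D * u' ^ 2 := by positivity
        omega
      rw [e1, ← hvu'] at hvu
      have hA1 : (A : ℚ) ≠ 0 := by exact_mod_cast hA.ne'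
      have := add_right_cancel hvu
      exact mul_left_cancel₀ hA1 this
  have hb := h (3 * A * N) (by positivity)
  rw [le_div_iff₀ (Real.sqrt_pos.2 hlog)]
  have hcard' : ({q : ℚ | (N : ℚ) ≤ q ∧ q ≤ 2 * N ∧ q ∈ R}.ncard : ℝ) ≤ F.card := by
    exact_mod_cast hcard
  have hA' : (1 : ℝ) ≤ A := by exact_mod_cast hA
  have hs : √(Real.log N) ≤ √(1 + Real.log ((3 * A * N : ℕ) : ℝ)) := by
    apply Real.sqrt_le_sqrt
    have : Real.log N ≤ Real.log ((3 * A * N : ℕ) : ℝ) := by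
      apply Real.log_le_log (by linarith)
      push_cast
      nlinarith
    linarith
  calc _ ≤ (F.card : ℝ) * √(1 + Real.log ((3 * A * N : ℕ) : ℝ)) := by gcongr
    _ ≤ C * ((3 * A * N : ℕ) : ℝ) := hb
    _ = _ := by push_cast; ring

lemma lin_unbdd (a b c : ℚ) (h : a < 0 ∨ (a = 0 ∧ b ≠ 0)) (M : ℚ) :
    ∃ t : ℤ, a * t ^ 2 + b * t + c < -M := by
  rcases h with h | ⟨rfl, h⟩
  · obtain ⟨n, hn⟩ := exists_nat_gt (max 1 ((|b| + |c| + |M|) / -a))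
    have h1 : (1 : ℚ) < n := lt_of_le_of_lt (le_max_left _ _) hn
    have h2 : (|b| + |c| + |M|) / -a < n := lt_of_le_of_lt (le_max_right _ _) hn
    rw [div_lt_iff₀ (by linarith)] at h2
    refine ⟨n, ?_⟩
    push_cast
    have hb := le_abs_self b
    have hc := le_abs_self c
    have hM := le_abs_self M
    have hc0 := abs_nonneg c
    have hM0 := abs_nonneg M
    have h3 : (|b| + |c| + |M|) * n < (n * -a) * n := mul_lt_mul_of_pos_right h2 (by linarith)
    have h4 : b * n ≤ |b| * n := mul_le_mul_of_nonneg_right hb (by linarith)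
    have h5 : |c| ≤ |c| * n := le_mul_of_one_le_right hc0 h1.le
    have h6 : |M| ≤ |M| * n := le_mul_of_one_le_right hM0 h1.le
    nlinarith
  · obtain ⟨n, hn⟩ := exists_nat_gt ((|c| + |M|) / |b|)
    have hb0 : 0 < |b| := abs_pos.2 h
    rw [div_lt_iff₀ hb0] at hn
    have hc := le_abs_self c
    have hM := le_abs_self M
    rcases lt_or_gt_of_ne h with hb | hb
    · refine ⟨n, ?_⟩
      rw [abs_of_neg hb] at hn
      push_cast; linarith
    · refine ⟨-n, ?_⟩
      rw [abs_of_pos hb] at hn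
      push_cast; linarith

/-- integer quadratic polynomial -/
lemma int_case (a b c e f g : ℤ) (h : ¬ (a = 0 ∧ b = 0 ∧ c = 0)) :
    (∀ M : ℚ, ∃ x y : ℤ,
      (a * x ^ 2 + b * x * y + c * y ^ 2 + e * x + f * y + g : ℚ) < -M) ∨
    ∃ (A : ℕ) (B : ℤ) (D : ℕ), 0 < A ∧ 0 < D ∧ ∀ x y : ℤ, ∃ v u : ℤ,
      A * (a * x ^ 2 + b * x * y + c * y ^ 2 + e * x + f * y + g) + B = v ^ 2 + D * u ^ 2 := by
  have key : ∀ u v : ℤ, (a * u ^ 2 + b * u * v + c * v ^ 2 < 0 ∨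
      (a * u ^ 2 + b * u * v + c * v ^ 2 = 0 ∧ e * u + f * v ≠ 0)) →
      (∀ M : ℚ, ∃ x y : ℤ,
      (a * x ^ 2 + b * x * y + c * y ^ 2 + e * x + f * y + g : ℚ) < -M) := by
    intro u v huv M
    obtain ⟨t, ht⟩ := lin_unbdd ((a * u ^ 2 + b * u * v + c * v ^ 2 : ℤ) : ℚ)
      ((e * u + f * v : ℤ) : ℚ) g (by exact_mod_cast huv) M
    refine ⟨t * u, t * v, ?_⟩
    push_cast at ht ⊢
    linarith
  by_cases hk : ∃ u v : ℤ, (a * u ^ 2 + b * u * v + c * v ^ 2 < 0 ∨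
      (a * u ^ 2 + b * u * v + c * v ^ 2 = 0 ∧ e * u + f * v ≠ 0))
  · obtain ⟨u, v, huv⟩ := hk
    exact Or.inl (key u v huv)
  push Not at hk
  right
  have ha : 0 ≤ a := by have := (hk 1 0).1; linarith
  have hc : 0 ≤ c := by have := (hk 0 1).1; linarith
  rcases ha.lt_or_eq with ha | ha
  · have hΔ : 0 ≤ 4 * a * c - b ^ 2 := by
      have := (hk (-b) (2 * a)).1
      have h2 : 0 ≤ a * (4 * a * c - b ^ 2) := by nlinarith
      exact nonneg_of_mul_nonneg_right h2 ha
    rcases hΔ.lt_or_eq with hΔ | hΔ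
    · refine ⟨(4 * a * (4 * a * c - b ^ 2)).toNat,
        -((4 * a * g - e ^ 2) * (4 * a * c - b ^ 2) - (2 * a * f - b * e) ^ 2),
        (4 * a * c - b ^ 2).toNat, ?_, ?_, ?_⟩
      · have : 0 < 4 * a * (4 * a * c - b ^ 2) := by positivity
        omega
      · omega
      · intro x y
        refine ⟨(4 * a * c - b ^ 2) * y + (2 * a * f - b * e), 2 * a * x + b * y + e, ?_⟩
        rw [Int.toNat_of_nonneg (by positivity), Int.toNat_of_nonneg hΔ.le]
        ring
    · have hl := (hk (-b) (2 * a)).2 (by linear_combination (-a) * hΔ)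
      refine ⟨(4 * a).toNat, -(4 * a * g - e ^ 2), 1, by omega, one_pos, ?_⟩
      intro x y
      refine ⟨2 * a * x + b * y + e, 0, ?_⟩
      rw [Int.toNat_of_nonneg (by positivity)]
      linear_combination 2 * y * hl - y ^ 2 * hΔ
  · subst ha
    have hb : b = 0 := by
      by_contra hb
      have h1 := (hk (-(c + 1) * b) 1).1
      have : 0 < b ^ 2 := by positivity
      nlinarith
    subst hb
    have hc : 0 < c := by
      rcases hc.lt_or_eq with h' | h'
      · exact h'
      · exact absurd ⟨rfl, rfl, h'.symm⟩ h
    have he := (hk 1 0).2 (by ring)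
    refine ⟨(4 * c).toNat, -(4 * c * g - f ^ 2), 1, by omega, one_pos, ?_⟩
    intro x y
    refine ⟨2 * c * y + f, 0, ?_⟩
    rw [Int.toNat_of_nonneg (by positivity)]
    linear_combination 4 * c * x * he

lemma exists_coeffs (Q : MvPolynomial (Fin 2) ℚ) (hdeg : Q.totalDegree = 2) :
    ∃ a b c e f g : ℚ, ¬ (a = 0 ∧ b = 0 ∧ c = 0) ∧ ∀ x y : ℚ,
      MvPolynomial.eval ![x, y] Q = a * x ^ 2 + b * x * y + c * y ^ 2 + e * x + f * y + g := by
  classical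
  let E : ℕ × ℕ → (Fin 2 →₀ ℕ) := fun p => Finsupp.single 0 p.1 + Finsupp.single 1 p.2
  have E0 : ∀ p, E p 0 = p.1 := fun p => by simp [E]
  have E1 : ∀ p, E p 1 = p.2 := fun p => by simp [E]
  have Einj : Function.Injective E := by
    intro p q h
    have h0 := E0 p
    have h1 := E1 p
    rw [h, E0] at h0
    rw [h, E1] at h1
    exact Prod.ext h0.symm h1.symm
  have Esurj : ∀ m : Fin 2 →₀ ℕ, m = E (m 0, m 1) := by
    intro m
    ext i
    fin_cases i
    · exact (E0 (m 0, m 1)).symm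
    · exact (E1 (m 0, m 1)).symm
  have hdegm : ∀ m ∈ Q.support, m 0 + m 1 ≤ 2 := by
    intro m hm
    have := MvPolynomial.le_totalDegree hm
    rw [hdeg, Finsupp.sum_fintype _ _ (fun _ => rfl)] at this
    simpa [Fin.sum_univ_two] using this
  let P : Finset (ℕ × ℕ) := {(2, 0), (1, 1), (0, 2), (1, 0), (0, 1), (0, 0)}
  have hsub : Q.support ⊆ P.image E := by
    intro m hm
    rw [Finset.mem_image]
    refine ⟨(m 0, m 1), ?_, (Esurj m).symm⟩
    have := hdegm m hm
    simp only [P, Finset.mem_insert, Finset.mem_singleton, Prod.mk.injEq]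
    omega
  refine ⟨Q.coeff (E (2, 0)), Q.coeff (E (1, 1)), Q.coeff (E (0, 2)), Q.coeff (E (1, 0)),
    Q.coeff (E (0, 1)), Q.coeff (E (0, 0)), ?_, ?_⟩
  · rintro ⟨h1, h2, h3⟩
    have : Q.totalDegree ≤ 1 := by
      rw [MvPolynomial.totalDegree]
      apply Finset.sup_le
      intro m hm
      rw [Finsupp.sum_fintype _ _ (fun _ => rfl), Fin.sum_univ_two]
      by_contra hc
      have h2' := hdegm m hm
      have hne := MvPolynomial.mem_support_iff.1 hm
      have hcases : (m 0 = 2 ∧ m 1 = 0) ∨ (m 0 = 1 ∧ m 1 = 1) ∨ (m 0 = 0 ∧ m 1 = 2) := by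
        omega
      rw [Esurj m] at hne
      rcases hcases with ⟨p, q⟩ | ⟨p, q⟩ | ⟨p, q⟩ <;> rw [p, q] at hne
      · exact hne h1
      · exact hne h2
      · exact hne h3
    omega
  · intro x y
    rw [MvPolynomial.eval_eq', Finset.sum_subset hsub, Finset.sum_image (fun p _ q _ h => Einj h)]
    · simp only [Fin.prod_univ_two, E0, E1]
      simp [P]
      ring
    · intro m _ hm
      rw [MvPolynomial.notMem_support_iff.1 hm, zero_mul]

lemma scale (q : ℚ) (n : ℕ) (h : q.den ∣ n) : ∃ z : ℤ, (n : ℚ) * q = z := by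
  obtain ⟨k, rfl⟩ := h
  refine ⟨k * q.num, ?_⟩
  push_cast
  have := Rat.mul_den_eq_num q
  linear_combination (k : ℚ) * this

end QD
/-- **Corollary 5.3.** Let `Q ∈ ℚ[x,y]` be a quadratic polynomial.
Then either `#ℛ_Q([N,2N]) ≪ N/√(log N)`, or `inf_{(x,y) ∈ ℤ²} Q(x,y) = -∞`.
In particular, no quadratic `Q ∈ ℚ[x,y]` satisfies `Q(ℤ²) = ℤ_{≥0}`. -/
theorem quadratic_density_or_inf
    (Q : MvPolynomial (Fin 2) ℚ) (hdeg : Q.totalDegree = 2) :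
    ((∃ c : ℝ, 0 < c ∧ ∀ᶠ N : ℕ in Filter.atTop,
        ({q : ℚ | (N : ℚ) ≤ q ∧ q ≤ 2 * N ∧
            ∃ x y : ℤ, MvPolynomial.eval ![(x : ℚ), (y : ℚ)] Q = q}.ncard : ℝ)
          ≤ c * N / Real.sqrt (Real.log N)) ∨
      (∀ M : ℚ, ∃ x y : ℤ, MvPolynomial.eval ![(x : ℚ), (y : ℚ)] Q < -M)) ∧
    {q : ℚ | ∃ x y : ℤ, MvPolynomial.eval ![(x : ℚ), (y : ℚ)] Q = q}
      ≠ {q : ℚ | ∃ n : ℕ, q = (n : ℚ)} := by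
  have main : ((∃ c : ℝ, 0 < c ∧ ∀ᶠ N : ℕ in Filter.atTop,
        ({q : ℚ | (N : ℚ) ≤ q ∧ q ≤ 2 * N ∧
            ∃ x y : ℤ, MvPolynomial.eval ![(x : ℚ), (y : ℚ)] Q = q}.ncard : ℝ)
          ≤ c * N / Real.sqrt (Real.log N)) ∨
      (∀ M : ℚ, ∃ x y : ℤ, MvPolynomial.eval ![(x : ℚ), (y : ℚ)] Q < -M)) := by
    obtain ⟨a, b, c, e, f, g, hne, hev⟩ := QD.exists_coeffs Q hdeg
    set K : ℕ := a.den * b.den * c.den * e.den * f.den * g.den with hK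
    have hK0 : 0 < K := by
      have := a.den_pos; have := b.den_pos; have := c.den_pos
      have := e.den_pos; have := f.den_pos; have := g.den_pos
      positivity
    obtain ⟨a', ha⟩ := QD.scale a K ⟨b.den * c.den * e.den * f.den * g.den, by rw [hK]; ring⟩
    obtain ⟨b', hb⟩ := QD.scale b K ⟨a.den * c.den * e.den * f.den * g.den, by rw [hK]; ring⟩
    obtain ⟨c', hc⟩ := QD.scale c K ⟨a.den * b.den * e.den * f.den * g.den, by rw [hK]; ring⟩
    obtain ⟨e', he⟩ := QD.scale e K ⟨a.den * b.den * c.den * f.den * g.den, by rw [hK]; ring⟩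
    obtain ⟨f', hf⟩ := QD.scale f K ⟨a.den * b.den * c.den * e.den * g.den, by rw [hK]; ring⟩
    obtain ⟨g', hg⟩ := QD.scale g K ⟨a.den * b.den * c.den * e.den * f.den, by rw [hK]; ring⟩
    have hKq : (0 : ℚ) < K := by exact_mod_cast hK0
    have hev' : ∀ x y : ℤ, (K : ℚ) * MvPolynomial.eval ![(x : ℚ), (y : ℚ)] Q =
        a' * x ^ 2 + b' * x * y + c' * y ^ 2 + e' * x + f' * y + g' := by
      intro x y
      rw [hev, ← ha, ← hb, ← hc, ← he, ← hf, ← hg]; ring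
    have hne' : ¬ (a' = 0 ∧ b' = 0 ∧ c' = 0) := by
      rintro ⟨rfl, rfl, rfl⟩
      apply hne
      simpa [hKq.ne'] using And.intro ha (And.intro hb hc)
    rcases QD.int_case a' b' c' e' f' g' hne' with h | ⟨A, B, D, hA, hD, h⟩
    · right
      intro M
      obtain ⟨x, y, hxy⟩ := h (K * M)
      refine ⟨x, y, ?_⟩
      rw [← hev'] at hxy
      nlinarith
    · left
      refine QD.rep_count (A * K) (by positivity) B D hD
        {q | ∃ x y : ℤ, MvPolynomial.eval ![(x : ℚ), (y : ℚ)] Q = q} ?_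
      rintro q ⟨x, y, rfl⟩
      obtain ⟨v, u, hvu⟩ := h x y
      refine ⟨v, u, ?_⟩
      rw [← hvu]
      push_cast
      rw [mul_assoc, hev']
  refine ⟨main, ?_⟩
  intro hEq
  rcases main with ⟨c, hc, h⟩ | h
  · have ht : Filter.Tendsto (fun N : ℕ => Real.log N) Filter.atTop Filter.atTop :=
      Real.tendsto_log_atTop.comp tendsto_natCast_atTop_atTop
    obtain ⟨N, hN, hl, hN0⟩ := (h.and ((ht.eventually_gt_atTop (c ^ 2)).and
      (Filter.eventually_gt_atTop 0))).exists
    have hset : {q : ℚ | (N : ℚ) ≤ q ∧ q ≤ 2 * N ∧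
            ∃ x y : ℤ, MvPolynomial.eval ![(x : ℚ), (y : ℚ)] Q = q} =
        (fun n : ℕ => (n : ℚ)) '' (Finset.Icc N (2 * N) : Finset ℕ) := by
      ext q
      have hq : (∃ x y : ℤ, MvPolynomial.eval ![(x : ℚ), (y : ℚ)] Q = q) ↔
          ∃ n : ℕ, q = (n : ℚ) := Set.ext_iff.1 hEq q
      rw [Set.mem_setOf_eq, hq]
      constructor
      · rintro ⟨h1, h2, n, rfl⟩
        refine ⟨n, ?_, rfl⟩
        rw [Finset.mem_coe, Finset.mem_Icc]
        exact ⟨by exact_mod_cast h1, by exact_mod_cast h2⟩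
      · rintro ⟨n, hn, rfl⟩
        rw [Finset.mem_coe, Finset.mem_Icc] at hn
        beta_reduce
        exact ⟨by exact_mod_cast hn.1, by exact_mod_cast hn.2, n, rfl⟩
    rw [hset, Set.ncard_image_of_injective _ Nat.cast_injective, Set.ncard_coe_finset,
      Nat.card_Icc] at hN
    have hl0 : 0 < Real.log N := lt_of_le_of_lt (sq_nonneg c) hl
    have hs : c < √(Real.log N) := Real.lt_sqrt_of_sq_lt hl
    rw [le_div_iff₀ (Real.sqrt_pos.2 hl0)] at hN
    have e1 : 2 * N + 1 - N = N + 1 := by omega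
    rw [e1] at hN
    push_cast at hN
    have hN0' : (0 : ℝ) < N := by exact_mod_cast hN0
    nlinarith
  · obtain ⟨x, y, hxy⟩ := h 0
    have : MvPolynomial.eval ![(x : ℚ), (y : ℚ)] Q ∈ {q : ℚ | ∃ n : ℕ, q = (n : ℚ)} := by
      rw [← hEq]; exact ⟨x, y, rfl⟩
    obtain ⟨n, hn⟩ := this
    rw [hn] at hxy
    have : (0 : ℚ) ≤ n := by positivity
    linarith
end

section
/- Let H ∈ ℤ[x,y] be an indefinite integral binary quadratic form that is irreducible over ℚ, let ξ ∈ [0,2π) satisfy H(cos ξ, sin ξ) = 0, and let m₁, m₂ ∈ ℤ and d a positive integer. Then there exist a constant c > 0 and an infinite sequence of pairs of integers (x_i, y_i) with x_i² + y_i² → ∞ such that |H(d x_i + m₁, d y_i + m₂)| ≤ c and |arg(x_i, y_i) − ξ| ≤ c/√(x_i² + y_i²) for all i. -/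
/-- Evaluation of an integer polynomial in two variables at a real point. -/
noncomputable def evalReal (G : MvPolynomial (Fin 2) ℤ) (x y : ℝ) : ℝ :=
  MvPolynomial.aeval ![x, y] G

/-- An integral binary form is indefinite if it takes both positive and negative
values on `ℝ²`. -/
def Indefinite2 (G : MvPolynomial (Fin 2) ℤ) : Prop :=
  (∃ x y : ℝ, 0 < evalReal G x y) ∧ (∃ x y : ℝ, evalReal G x y < 0)

/-- The image of an integral polynomial in `ℚ[x,y]`. -/
noncomputable def toQ (G : MvPolynomial (Fin 2) ℤ) : MvPolynomial (Fin 2) ℚ :=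
  MvPolynomial.map (Int.castRingHom ℚ) G

section helpers
open MvPolynomial

theorem quad_form_expand (H : MvPolynomial (Fin 2) ℤ) (hH : H.IsHomogeneous 2) :
    ∃ a b c : ℤ, H = C a * X 0 ^ 2 + C b * (X 0 * X 1) + C c * X 1 ^ 2 := by
  refine ⟨H.coeff (Finsupp.single 0 2), H.coeff (Finsupp.single 0 1 + Finsupp.single 1 1),
    H.coeff (Finsupp.single 1 2), ?_⟩
  have e1 : (X 0 ^ 2 : MvPolynomial (Fin 2) ℤ) = monomial (Finsupp.single 0 2) 1 := by
    rw [X_pow_eq_monomial]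
  have e2 : (X 1 ^ 2 : MvPolynomial (Fin 2) ℤ) = monomial (Finsupp.single 1 2) 1 := by
    rw [X_pow_eq_monomial]
  have e3 : (X 0 * X 1 : MvPolynomial (Fin 2) ℤ)
      = monomial (Finsupp.single 0 1 + Finsupp.single 1 1) 1 := by
    simp [X, monomial_mul]
  rw [e1, e2, e3]
  ext m
  simp only [coeff_add, coeff_C_mul, coeff_monomial]
  have key : ∀ n : Fin 2 →₀ ℕ, n = m ↔ n 0 = m 0 ∧ n 1 = m 1 := by
    intro n
    constructor
    · rintro rfl; simp
    · rintro ⟨h0, h1⟩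
      ext i; fin_cases i <;> assumption
  by_cases hm : m 0 + m 1 = 2
  · have h3 : m 0 = 0 ∨ m 0 = 1 ∨ m 0 = 2 := by omega
    rcases h3 with h | h | h
    · have h1 : m 1 = 2 := by omega
      have := (key (Finsupp.single 1 2)).2 (by simp [h, h1])
      subst this
      simp [key]
    · have h1 : m 1 = 1 := by omega
      have := (key (Finsupp.single 0 1 + Finsupp.single 1 1)).2 (by simp [h, h1])
      subst this
      simp [key]
    · have h1 : m 1 = 0 := by omega
      have := (key (Finsupp.single 0 2)).2 (by simp [h, h1])
      subst this
      simp [key]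
  · rw [hH.coeff_eq_zero (by simpa [Finsupp.degree_eq_sum] using hm)]
    simp only [key]
    rw [if_neg, if_neg, if_neg] <;> simp <;> omega

theorem disc_not_square (a b c : ℤ) (h : Irreducible
    (MvPolynomial.map (Int.castRingHom ℚ)
      (C a * X 0 ^ 2 + C b * (X 0 * X 1) + C c * X 1 ^ 2 : MvPolynomial (Fin 2) ℤ))) :
    ¬ IsSquare (b ^ 2 - 4 * a * c) := by
  rintro ⟨e, he⟩
  have nu : ∀ p : MvPolynomial (Fin 2) ℚ, eval (0 : Fin 2 → ℚ) p = 0 → ¬ IsUnit p := by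
    intro p hp hu
    have := hu.map (eval (0 : Fin 2 → ℚ))
    rw [hp] at this
    simp at this
  by_cases ha : a = 0
  · subst ha
    rcases h.isUnit_or_isUnit (a := X 1) (b := C (b:ℚ) * X 0 + C (c:ℚ) * X 1)
      (by simp; ring) with h | h
    · exact nu _ (by simp) h
    · exact nu _ (by simp) h
  · have ha' : (a:ℚ) ≠ 0 := by exact_mod_cast ha
    have hc : (c:ℚ) = (b^2 - e^2) / (4*a) := by
      field_simp
      have : (b:ℚ)^2 - 4*a*c = e*e := by exact_mod_cast he
      linarith
    rcases h.isUnit_or_isUnit (a := C (a:ℚ) * X 0 + C ((b - e)/2 : ℚ) * X 1)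
      (b := X 0 + C ((b+e)/(2*a) : ℚ) * X 1)
      (by
        have h1 : (c:ℚ) = ((b - e)/2 : ℚ) * ((b+e)/(2*a) : ℚ) := by rw [hc]; field_simp; ring
        have h2 : (b:ℚ) = a * ((b+e)/(2*a) : ℚ) + ((b - e)/2 : ℚ) := by field_simp; ring
        have h1' := congrArg (C (σ := Fin 2)) h1
        have h2' := congrArg (C (σ := Fin 2)) h2
        simp only [map_add, map_mul, map_pow, map_C, map_X] at h1' h2' ⊢
        simp only [eq_intCast] at h1' h2' ⊢
        linear_combination (X 0 * X 1) * h2' + X 1 ^ 2 * h1') with h | h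
    · exact nu _ (by simp) h
    · exact nu _ (by simp) h

theorem angle_lemma (ξ x y M : ℝ) (hs : 1 ≤ Real.cos ξ * x + Real.sin ξ * y)
    (ht : |-Real.sin ξ * x + Real.cos ξ * y| ≤ M) :
    ∃ θ : ℝ, θ ∈ Set.Ico 0 (2 * Real.pi) ∧
      Real.cos θ = x / Real.sqrt (x ^ 2 + y ^ 2) ∧
      Real.sin θ = y / Real.sqrt (x ^ 2 + y ^ 2) ∧
      ∃ k : ℤ, |θ - ξ + 2 * Real.pi * k| ≤ (M * (1 + M)) / Real.sqrt (x ^ 2 + y ^ 2) := by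
  obtain ⟨s, hsd⟩ : ∃ s, s = Real.cos ξ * x + Real.sin ξ * y := ⟨_, rfl⟩
  obtain ⟨t, htd⟩ : ∃ t, t = -Real.sin ξ * x + Real.cos ξ * y := ⟨_, rfl⟩
  rw [← hsd] at hs
  rw [← htd] at ht
  have cs := Real.sin_sq_add_cos_sq ξ
  have hx : x = Real.cos ξ * s - Real.sin ξ * t := by
    rw [hsd, htd]; linear_combination -x * cs
  have hy : y = Real.sin ξ * s + Real.cos ξ * t := by
    rw [hsd, htd]; linear_combination -y * cs
  have hr : x ^ 2 + y ^ 2 = s ^ 2 + t ^ 2 := by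
    rw [hx, hy]; linear_combination (s^2+t^2) * cs
  have s0 : 0 < s := by linarith
  have hM : 0 ≤ M := (abs_nonneg t).trans ht
  have hR : Real.sqrt (x ^ 2 + y ^ 2) = s * Real.sqrt (1 + (t / s) ^ 2) := by
    rw [hr, ← Real.sqrt_sq s0.le, ← Real.sqrt_mul (by positivity), Real.sqrt_sq s0.le]
    congr 1; field_simp
  have hq : 0 < Real.sqrt (1 + (t / s) ^ 2) := by positivity
  have hp : 0 < 2 * Real.pi := by positivity
  have hmod := toIcoMod_add_toIcoDiv_zsmul hp 0 (ξ + Real.arctan (t / s))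
  have hθ : toIcoMod hp 0 (ξ + Real.arctan (t / s)) = (ξ + Real.arctan (t / s)) -
      (toIcoDiv hp 0 (ξ + Real.arctan (t / s)) : ℤ) * (2 * Real.pi) := by
    rw [zsmul_eq_mul] at hmod; linarith
  refine ⟨toIcoMod hp 0 (ξ + Real.arctan (t / s)), ?_, ?_, ?_,
    toIcoDiv hp 0 (ξ + Real.arctan (t / s)), ?_⟩
  · simpa using toIcoMod_mem_Ico hp 0 (ξ + Real.arctan (t / s))
  · rw [hθ, Real.cos_sub_int_mul_two_pi, Real.cos_add, Real.cos_arctan, Real.sin_arctan, hR]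
    rw [hx]; field_simp
  · rw [hθ, Real.sin_sub_int_mul_two_pi, Real.sin_add, Real.cos_arctan, Real.sin_arctan, hR]
    rw [hy]; field_simp
  · have e : toIcoMod hp 0 (ξ + Real.arctan (t / s)) - ξ +
        2 * Real.pi * (toIcoDiv hp 0 (ξ + Real.arctan (t / s)) : ℤ) = Real.arctan (t / s) := by
      rw [hθ]; ring
    rw [e]
    have h1 : |Real.arctan (t / s)| ≤ |t / s| := by
      have h2 : ∀ z : ℝ, 0 ≤ z → Real.arctan z ≤ z := fun z hz => by
        have := Real.le_tan (Real.arctan_nonneg.2 hz) (Real.arctan_lt_pi_div_two z)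
        rwa [Real.tan_arctan] at this
      rcases le_total 0 (t / s) with h | h
      · rw [abs_of_nonneg h, abs_of_nonneg (Real.arctan_nonneg.2 h)]; exact h2 _ h
      · rw [abs_of_nonpos h, abs_of_nonpos (by simpa using h), ← Real.arctan_neg]
        exact h2 _ (by linarith)
    refine h1.trans ?_
    rw [abs_div, abs_of_pos s0, le_div_iff₀ (by rw [hR]; positivity)]
    have h3 : Real.sqrt (x ^ 2 + y ^ 2) ≤ s * (1 + M) := by
      rw [hr]
      apply Real.sqrt_le_iff.2 ⟨by positivity, ?_⟩
      have : t ^ 2 ≤ M ^ 2 := by rw [← sq_abs]; gcongr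
      nlinarith [mul_nonneg (sub_nonneg.2 hs) hM, mul_nonneg hM hM, mul_nonneg (mul_nonneg hM hM) (sub_nonneg.2 hs), mul_nonneg (mul_nonneg s0.le s0.le) hM, mul_nonneg (mul_nonneg (mul_nonneg hM hM) (sub_nonneg.2 hs)) s0.le]
    calc |t| / s * Real.sqrt (x ^ 2 + y ^ 2) ≤ M / s * (s * (1 + M)) := by gcongr
      _ = M * (1 + M) := by field_simp

theorem start_point (α β m1 m2 d : ℝ) (hd : 0 < d) (h : α ≠ 0 ∨ β ≠ 0) :
    ∃ x y : ℤ, 0 < α * (d * x + m1) + β * (d * y + m2) := by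
  have key : ∀ γ κ : ℝ, γ ≠ 0 → ∃ x : ℤ, 0 < γ * x + κ := by
    intro γ κ hγ
    obtain ⟨n, hn⟩ := exists_nat_gt (-κ / |γ|)
    have hg : 0 < |γ| := abs_pos.2 hγ
    rw [div_lt_iff₀ hg] at hn
    rcases lt_or_gt_of_ne hγ with h | h
    · refine ⟨-n, ?_⟩
      rw [abs_of_neg h] at hn
      push_cast; linarith
    · refine ⟨n, ?_⟩
      rw [abs_of_pos h] at hn
      push_cast; linarith
  rcases h with h | h
  · obtain ⟨x, hx⟩ := key (α * d) (α * m1 + β * m2) (mul_ne_zero h hd.ne')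
    exact ⟨x, 0, by push_cast; linarith⟩
  · obtain ⟨x, hx⟩ := key (β * d) (α * m1 + β * m2) (mul_ne_zero h hd.ne')
    exact ⟨0, x, by push_cast; linarith⟩

theorem seq_lemma (a b c : ℤ) (u v : ℝ) (huv : u ^ 2 + v ^ 2 = 1)
    (h0 : a * u ^ 2 + b * (u * v) + c * v ^ 2 = 0)
    (hns : ¬ IsSquare (b ^ 2 - 4 * a * c)) (m1 m2 d : ℤ) (hd : 0 < d) :
    ∃ (T : ℝ) (h : ℤ) (f : ℕ → ℤ × ℤ),
      (∀ i, a * (d * (f i).1 + m1) ^ 2 + b * ((d * (f i).1 + m1) * (d * (f i).2 + m2)) +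
        c * (d * (f i).2 + m2) ^ 2 = h) ∧
      (∀ i, |-v * (d * (f i).1 + m1) + u * (d * (f i).2 + m2)| ≤ T) ∧
      Filter.Tendsto (fun i => u * (d * (f i).1 + m1 : ℝ) + v * (d * (f i).2 + m2))
        Filter.atTop Filter.atTop := by
  obtain ⟨B, hB⟩ : ∃ B : ℝ, B = -2 * a * u * v + b * (u ^ 2 - v ^ 2) + 2 * c * u * v := ⟨_, rfl⟩
  have gx : 2 * a * u + b * v = -v * B := by
    rw [hB]; linear_combination (2 * u) * h0 - (2 * a * u + b * v) * huv
  have gy : b * u + 2 * c * v = u * B := by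
    rw [hB]; linear_combination (2 * v) * h0 - (b * u + 2 * c * v) * huv
  have hD : B ^ 2 = ((b ^ 2 - 4 * a * c : ℤ) : ℝ) := by
    push_cast
    rw [hB]
    linear_combination 4 * (a * v ^ 2 - b * u * v + c * u ^ 2) * h0 +
      (b ^ 2 - 4 * a * c) * (u ^ 2 + v ^ 2 + 1) * huv
  obtain ⟨D, hDd⟩ : ∃ D, D = b ^ 2 - 4 * a * c := ⟨_, rfl⟩
  rw [← hDd] at hD hns
  have hD0 : 0 < D := by
    have h1 : (0 : ℝ) ≤ D := by rw [← hD]; positivity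
    have h2 : 0 ≤ D := by exact_mod_cast h1
    rcases h2.lt_or_eq with h | h
    · exact h
    · exact absurd (h ▸ IsSquare.zero) hns
  have hB0 : B ≠ 0 := by
    rintro rfl
    have : (D : ℝ) = 0 := by rw [← hD]; ring
    have : D = 0 := by exact_mod_cast this
    omega
  -- Pell
  have hns' : ¬ IsSquare (D * d ^ 2) := by
    rintro ⟨r, hr⟩
    have hdr : d ∣ r := by
      rw [← Int.pow_dvd_pow_iff (n := 2) (by norm_num)]
      exact ⟨D, by rw [sq r, ← hr]; ring⟩
    obtain ⟨q, rfl⟩ := hdr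
    apply hns
    refine ⟨q, ?_⟩
    have : d ^ 2 ≠ 0 := by positivity
    apply mul_right_cancel₀ this
    rw [hr]; ring
  obtain ⟨e, k, hpell, hek, hk⟩ : ∃ e k : ℤ, (1 + d * e) ^ 2 - D * (d * k) ^ 2 = 1 ∧ 0 ≤ e ∧
      (d * k : ℝ) * B < 0 := by
    obtain ⟨x, y, hxy, hy⟩ := Pell.exists_of_not_isSquare (by positivity) hns'
    have hx : x ≠ 0 := by
      rintro rfl
      have : 0 ≤ D * d ^ 2 * y ^ 2 := by positivity
      linarith
    have hk0 : 2 * x * y ≠ 0 := by positivity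
    have hk1 : ((2 * x * y : ℤ) : ℝ) ≠ 0 := by exact_mod_cast hk0
    have hdR : (0 : ℝ) < d := by exact_mod_cast hd
    have hne : (d * (2 * x * y : ℤ) : ℝ) * B ≠ 0 := mul_ne_zero (mul_ne_zero hdR.ne' hk1) hB0
    have hp : (1 + d * (2 * D * d * y ^ 2)) ^ 2 - D * (d * (2 * x * y)) ^ 2 = 1 := by
      linear_combination (-4 * D * d ^ 2 * y ^ 2) * hxy
    rcases lt_or_gt_of_ne hne with h | h
    · exact ⟨2 * D * d * y ^ 2, 2 * x * y, hp, by positivity, h⟩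
    · refine ⟨2 * D * d * y ^ 2, -(2 * x * y), by linear_combination hp, by positivity, ?_⟩
      push_cast at h ⊢
      linarith
  obtain ⟨x0, y0, hxy0⟩ := start_point (B * (B * u - (a + c) * v)) (B * (B * v + (a + c) * u))
    m1 m2 d (by exact_mod_cast hd) (by
      by_contra! hcon
      apply hB0
      have : B ^ 2 = 0 := by
        linear_combination u * hcon.1 + v * hcon.2 - B ^ 2 * huv
      simpa using this)
  set step : ℤ × ℤ → ℤ × ℤ := fun z =>
    (z.1 + e * (d * z.1 + m1) + k * (-b * (d * z.1 + m1) - 2 * c * (d * z.2 + m2)),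
     z.2 + e * (d * z.2 + m2) + k * (2 * a * (d * z.1 + m1) + b * (d * z.2 + m2))) with hstep
  set f : ℕ → ℤ × ℤ := fun i => step^[i] (x0, y0) with hf
  have fs : ∀ i, f (i + 1) = step (f i) := fun i => Function.iterate_succ_apply' _ _ _
  have f0 : f 0 = (x0, y0) := rfl
  have fs1 : ∀ i, d * (f (i + 1)).1 + m1 = (1 + d * e) * (d * (f i).1 + m1) +
      d * k * (-b * (d * (f i).1 + m1) - 2 * c * (d * (f i).2 + m2)) := by
    intro i; rw [fs]; simp only [hstep]; ring
  have fs2 : ∀ i, d * (f (i + 1)).2 + m2 = (1 + d * e) * (d * (f i).2 + m2) +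
      d * k * (2 * a * (d * (f i).1 + m1) + b * (d * (f i).2 + m2)) := by
    intro i; rw [fs]; simp only [hstep]; ring
  clear_value f
  have fr1 : ∀ i, (d * (f (i + 1)).1 + m1 : ℝ) = (1 + d * e) * (d * (f i).1 + m1) +
      d * k * (-b * (d * (f i).1 + m1) - 2 * c * (d * (f i).2 + m2)) := by
    intro i; exact_mod_cast fs1 i
  have fr2 : ∀ i, (d * (f (i + 1)).2 + m2 : ℝ) = (1 + d * e) * (d * (f i).2 + m2) +
      d * k * (2 * a * (d * (f i).1 + m1) + b * (d * (f i).2 + m2)) := by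
    intro i; exact_mod_cast fs2 i
  set μ : ℝ := (1 + d * e) + d * k * B with hμ
  set ν : ℝ := (1 + d * e) - d * k * B with hν
  have hde : (0 : ℝ) ≤ d * e := by
    have : 0 ≤ d * e := by positivity
    exact_mod_cast this
  have hν1 : 1 < ν := by rw [hν]; linarith
  have hμν : μ * ν = 1 := by
    have h1 : ((1 + d * e) ^ 2 - D * (d * k) ^ 2 : ℝ) = 1 := by exact_mod_cast hpell
    rw [hμ, hν]
    linear_combination h1 - (d * k) ^ 2 * hD
  have hμ0 : 0 < μ := by
    by_contra! hcon
    nlinarith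
  have hμ1 : μ ≤ 1 := by nlinarith
  have ht : ∀ i, -v * (d * (f i).1 + m1) + u * (d * (f i).2 + m2) =
      μ ^ i * (-v * (d * x0 + m1) + u * (d * y0 + m2)) := by
    intro i
    induction i with
    | zero => simp [f0]
    | succ i ih =>
      rw [pow_succ, mul_right_comm, ← ih, fr1, fr2, hμ]
      linear_combination d * k * (d * (f i).1 + m1) * gx + d * k * (d * (f i).2 + m2) * gy
  have hl : ∀ i, (B * u - (a + c) * v) * (d * (f i).1 + m1) +
        (B * v + (a + c) * u) * (d * (f i).2 + m2) =
      ν ^ i * ((B * u - (a + c) * v) * (d * x0 + m1) + (B * v + (a + c) * u) * (d * y0 + m2)) := by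
    intro i
    induction i with
    | zero => simp [f0]
    | succ i ih =>
      rw [pow_succ, mul_right_comm, ← ih, fr1, fr2, hν]
      generalize (d * (f i).1 + m1 : ℝ) = p
      generalize (d * (f i).2 + m2 : ℝ) = q
      have e1 : -v * (-b * p - 2 * c * q) + u * (2 * a * p + b * q) = B * (-v * p + u * q) := by
        linear_combination p * gx + q * gy
      have e2 : u * (-b * p - 2 * c * q) + v * (2 * a * p + b * q) =
          - B * (u * p + v * q) - 2 * (a + c) * (-v * p + u * q) := by
        linear_combination -p * gy + q * gx
      linear_combination d * k * B * e2 + d * k * (a + c) * e1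
  set t0 : ℝ := -v * (d * x0 + m1) + u * (d * y0 + m2) with ht0
  have htb : ∀ i, |-v * (d * (f i).1 + m1) + u * (d * (f i).2 + m2)| ≤ |t0| := by
    intro i
    rw [ht, abs_mul, abs_of_pos (pow_pos hμ0 i)]
    exact mul_le_of_le_one_left (abs_nonneg _) (pow_le_one₀ hμ0.le hμ1)
  refine ⟨|t0|, a * (d * x0 + m1) ^ 2 + b * ((d * x0 + m1) * (d * y0 + m2)) +
        c * (d * y0 + m2) ^ 2, f, ?_, htb, ?_⟩
  · intro i
    induction i with
    | zero => simp [f0]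
    | succ i ih =>
      rw [← ih, fs1, fs2]
      generalize (d * (f i).1 + m1) = p
      generalize (d * (f i).2 + m2) = q
      rw [hDd] at hpell
      linear_combination (a * p ^ 2 + b * (p * q) + c * q ^ 2) * hpell
  · set K := (B * (B * u - (a + c) * v)) * (d * x0 + m1) +
      (B * (B * v + (a + c) * u)) * (d * y0 + m2) with hK
    have hB2 : 0 < B ^ 2 := by positivity
    have lower : ∀ i, (ν ^ i * K - |B * (a + c)| * |t0|) / B ^ 2 ≤
        u * (d * (f i).1 + m1 : ℝ) + v * (d * (f i).2 + m2) := by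
      intro i
      rw [div_le_iff₀ hB2]
      have e1 : (u * (d * (f i).1 + m1 : ℝ) + v * (d * (f i).2 + m2)) * B ^ 2 =
          ν ^ i * K - B * (a + c) * (-v * (d * (f i).1 + m1) + u * (d * (f i).2 + m2)) := by
        rw [hK]; linear_combination B * hl i
      rw [e1]
      have e2 := le_abs_self (B * (a + c) * (-v * (d * (f i).1 + m1) + u * (d * (f i).2 + m2)))
      rw [abs_mul] at e2
      have e3 := mul_le_mul_of_nonneg_left (htb i) (abs_nonneg (B * (a + c)))
      linarith
    refine Filter.tendsto_atTop_mono lower ?_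
    apply Filter.Tendsto.atTop_div_const hB2
    apply Filter.tendsto_atTop_add_const_right
    exact (tendsto_pow_atTop_atTop_of_one_lt hν1).atTop_mul_const hxy0

end helpers

/-- **Lemma 5.4.**  Let `H` be an indefinite irreducible integral binary
quadratic form, `ξ ∈ [0, 2π)` a zero of `H(cos ξ, sin ξ)`, `m₁, m₂ ∈ ℤ` and `d ∈ ℕ`.
Then there is an infinite sequence `(xᵢ, yᵢ)` of pairs of integers with
`xᵢ² + yᵢ² → ∞`, `|H(d xᵢ + m₁, d yᵢ + m₂)| ≪ 1` and
`|arg(xᵢ, yᵢ) - ξ| ≪ 1/√(xᵢ² + yᵢ²)` (distance measured in `ℝ/2πℤ`). -/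
theorem dirichlet_approximation_quadratic_form
    (H : MvPolynomial (Fin 2) ℤ) (hH : H.IsHomogeneous 2)
    (hindef : Indefinite2 H) (hirr : Irreducible (toQ H))
    (ξ : ℝ) (hξ : ξ ∈ Set.Ico 0 (2 * Real.pi))
    (hzero : evalReal H (Real.cos ξ) (Real.sin ξ) = 0)
    (m1 m2 : ℤ) (d : ℤ) (hd : 0 < d) :
    ∃ c : ℝ, 0 < c ∧ ∃ f : ℕ → ℤ × ℤ,
      Filter.Tendsto (fun i => (f i).1 ^ 2 + (f i).2 ^ 2) Filter.atTop Filter.atTop ∧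
      ∀ i : ℕ,
        (|MvPolynomial.eval ![d * (f i).1 + m1, d * (f i).2 + m2] H| : ℝ) ≤ c ∧
        ∃ θ : ℝ, θ ∈ Set.Ico 0 (2 * Real.pi) ∧
          Real.cos θ = ((f i).1 : ℝ) /
            Real.sqrt (((f i).1 : ℝ) ^ 2 + ((f i).2 : ℝ) ^ 2) ∧
          Real.sin θ = ((f i).2 : ℝ) /
            Real.sqrt (((f i).1 : ℝ) ^ 2 + ((f i).2 : ℝ) ^ 2) ∧
          ∃ k : ℤ, |θ - ξ + 2 * Real.pi * k| ≤
            c / Real.sqrt (((f i).1 : ℝ) ^ 2 + ((f i).2 : ℝ) ^ 2) := by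
  obtain ⟨a, b, c, rfl⟩ := quad_form_expand H hH
  have hns := disc_not_square a b c hirr
  have h0 : a * Real.cos ξ ^ 2 + b * (Real.cos ξ * Real.sin ξ) + c * Real.sin ξ ^ 2 = 0 := by
    simpa [evalReal] using hzero
  obtain ⟨T, h, f, hfh, hft, hfs⟩ := seq_lemma a b c (Real.cos ξ) (Real.sin ξ)
    (Real.cos_sq_add_sin_sq ξ) h0 hns m1 m2 d hd
  have hd1 : (1 : ℝ) ≤ d := by exact_mod_cast hd
  have hd0 : (0 : ℝ) < d := by linarith
  have hs : Filter.Tendsto (fun i => Real.cos ξ * ((f i).1 : ℝ) + Real.sin ξ * (f i).2)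
      Filter.atTop Filter.atTop := by
    have h1 := (Filter.tendsto_atTop_add_const_right _
      (-(Real.cos ξ * m1 + Real.sin ξ * m2)) hfs).atTop_div_const hd0
    refine h1.congr fun i => ?_
    field_simp
    ring
  obtain ⟨N, hN⟩ := Filter.eventually_atTop.1 (hs.eventually_ge_atTop 1)
  set M : ℝ := |T| + |-Real.sin ξ * m1 + Real.cos ξ * m2| with hM
  have hM0 : 0 ≤ M := by positivity
  have hc : 0 < M * (1 + M) + |(h : ℝ)| + 1 := by positivity
  refine ⟨M * (1 + M) + |(h : ℝ)| + 1, hc, fun i => f (i + N), ?_, ?_⟩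
  · have h2 : Filter.Tendsto (fun i => ((f i).1 ^ 2 + (f i).2 ^ 2 : ℝ)) Filter.atTop
        Filter.atTop := by
      refine Filter.tendsto_atTop_mono' _ ?_ hs
      filter_upwards [Filter.eventually_ge_atTop N] with i hi
      have h3 := hN i hi
      have h4 := Real.cos_sq_add_sin_sq ξ
      nlinarith [sq_nonneg (Real.cos ξ * ((f i).2 : ℝ) - Real.sin ξ * (f i).1)]
    have h3 : Filter.Tendsto (fun i => (f i).1 ^ 2 + (f i).2 ^ 2) Filter.atTop
        Filter.atTop := by
      rw [← tendsto_intCast_atTop_iff (R := ℝ)]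
      simpa using h2
    exact h3.comp (Filter.tendsto_add_atTop_nat N)
  · intro i
    refine ⟨?_, ?_⟩
    · have h1 := hfh (i + N)
      simp only [map_add, map_mul, map_pow, MvPolynomial.eval_C, MvPolynomial.eval_X,
        Matrix.cons_val_zero, Matrix.cons_val_one]
      rw [h1]
      have : 0 ≤ M * (1 + M) := by positivity
      linarith
    · have ht : |-Real.sin ξ * ((f (i + N)).1 : ℝ) + Real.cos ξ * (f (i + N)).2| ≤ M := by
        have h1 : |d * (-Real.sin ξ * ((f (i + N)).1 : ℝ) + Real.cos ξ * (f (i + N)).2)| ≤ M := by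
          have h2 := hft (i + N)
          have h3 : d * (-Real.sin ξ * ((f (i + N)).1 : ℝ) + Real.cos ξ * (f (i + N)).2) =
            (-Real.sin ξ * (d * (f (i + N)).1 + m1) + Real.cos ξ * (d * (f (i + N)).2 + m2)) -
              (-Real.sin ξ * m1 + Real.cos ξ * m2) := by ring
          rw [h3, hM]
          exact (abs_sub _ _).trans (add_le_add (h2.trans (le_abs_self T)) le_rfl)
        rw [abs_mul, abs_of_pos hd0] at h1
        exact (le_mul_of_one_le_left (abs_nonneg _) hd1).trans h1
      obtain ⟨θ, h1, h2, h3, k, h4⟩ := angle_lemma ξ _ _ M (hN (i + N) (by omega)) ht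
      refine ⟨θ, h1, h2, h3, k, h4.trans ?_⟩
      gcongr
      have := abs_nonneg (h : ℝ)
      linarith
end

section
/- Let F ∈ ℤ[x,y] have total degree 4 with F(0,0) = 0, write F = F_4 + F_3 + F_2 + F_1 with F_i the homogeneous degree-i part, suppose F_4 is positive semi-definite, and suppose gcd(F̃_4, F_3, F_2, F_1) has degree 2, so that F factors as F(x,y) = H(x,y)·G(x,y) with H a primitive integral quadratic form and G an integral quadratic polynomial. Then for every positive integer C and every integer D, F(ℤ²) ≠ (Cℤ)_{≥D} = {Cn : n ∈ ℤ, Cn ≥ D}. -/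
open MvPolynomial

/-- An integral binary form (or polynomial) is positive semi-definite if it is
nonnegative at every real point. -/
def PosSemidef2 (G : MvPolynomial (Fin 2) ℤ) : Prop :=
  ∀ x y : ℝ, 0 ≤ evalReal G x y

/-- Positive definite: positive at every nonzero real point. -/
def PosDef2 (G : MvPolynomial (Fin 2) ℤ) : Prop :=
  ∀ x y : ℝ, (x, y) ≠ (0, 0) → 0 < evalReal G x y

/-- A primitive integral polynomial: the gcd of its coefficients is a unit. -/
def IsPrimitiveInt (G : MvPolynomial (Fin 2) ℤ) : Prop :=
  ∀ d : ℤ, (∀ m, d ∣ MvPolynomial.coeff m G) → IsUnit d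

/-- `Ft4` is the polynomial `F̃₄ = F₄ / P₀`, where `P₀` is the positive definite integral
form of largest degree (possibly a positive constant) dividing `F₄` such that the quotient
is a primitive integral form. -/
def IsTildePart (F4 Ft4 : MvPolynomial (Fin 2) ℤ) : Prop :=
  ∃ (P0 : MvPolynomial (Fin 2) ℤ) (k : ℕ),
    P0.IsHomogeneous k ∧ PosDef2 P0 ∧ F4 = P0 * Ft4 ∧
    (∃ n, Ft4.IsHomogeneous n) ∧ IsPrimitiveInt Ft4 ∧
    (∀ (P0' Ft4' : MvPolynomial (Fin 2) ℤ) (k' : ℕ),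
      P0'.IsHomogeneous k' → PosDef2 P0' → F4 = P0' * Ft4' →
      (∃ n, Ft4'.IsHomogeneous n) → IsPrimitiveInt Ft4' → k' ≤ k)

/-- Two integral polynomials have a common non-constant factor over `ℚ`
(i.e. their gcd in `ℚ[x,y]` is not 1). -/
def CommonFactor2 (A B : MvPolynomial (Fin 2) ℤ) : Prop :=
  ∃ d : MvPolynomial (Fin 2) ℚ, 0 < d.totalDegree ∧ d ∣ toQ A ∧ d ∣ toQ B

/-- Three integral polynomials have a common non-constant factor over `ℚ`. -/
def CommonFactor3 (A B C : MvPolynomial (Fin 2) ℤ) : Prop :=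
  ∃ d : MvPolynomial (Fin 2) ℚ, 0 < d.totalDegree ∧ d ∣ toQ A ∧ d ∣ toQ B ∧ d ∣ toQ C

/-- Four integral polynomials have a common non-constant factor over `ℚ`. -/
def CommonFactor4 (A B C D : MvPolynomial (Fin 2) ℤ) : Prop :=
  ∃ d : MvPolynomial (Fin 2) ℚ, 0 < d.totalDegree ∧
    d ∣ toQ A ∧ d ∣ toQ B ∧ d ∣ toQ C ∧ d ∣ toQ D

/-- The value set `F(ℤ²)`. -/
def valueSet (F : MvPolynomial (Fin 2) ℤ) : Set ℤ :=
  {m : ℤ | ∃ x y : ℤ, MvPolynomial.eval ![x, y] F = m}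

/-- The set `(Cℤ)_{≥ D} = {Cn : n ∈ ℤ, Cn ≥ D}`. -/
def targetSet (C D : ℤ) : Set ℤ :=
  {m : ℤ | (∃ n : ℤ, m = C * n) ∧ D ≤ m}


def SmallSet (S : Set ℕ) : Prop := Summable (S.indicator (fun n : ℕ => (1:ℝ)/n))

theorem SmallSet.mono {S T : Set ℕ} (hT : SmallSet T) (h : S ⊆ T) : SmallSet S := by
  refine Summable.of_nonneg_of_le (fun n => ?_) (fun n => ?_) hT
  · exact Set.indicator_nonneg (fun n _ => by positivity) n
  · exact Set.indicator_le_indicator_of_subset h (fun n => by positivity) n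

theorem SmallSet.union {S T : Set ℕ} (hS : SmallSet S) (hT : SmallSet T) : SmallSet (S ∪ T) := by
  refine Summable.of_nonneg_of_le (fun n => ?_) (fun n => ?_) (hS.add hT)
  · exact Set.indicator_nonneg (fun n _ => by positivity) n
  · have : (0:ℝ) ≤ 1 / n := by positivity
    by_cases h1 : n ∈ S <;> by_cases h2 : n ∈ T <;> simp [h1, h2]

theorem SmallSet.of_finite {S : Set ℕ} (hS : S.Finite) : SmallSet S := by
  apply summable_of_hasFiniteSupport
  exact hS.subset (by simp [Function.support])

theorem SmallSet.biUnion {ι : Type*} (s : Finset ι) (f : ι → Set ℕ) (h : ∀ i ∈ s, SmallSet (f i)) :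
    SmallSet (⋃ i ∈ s, f i) := by
  classical
  induction s using Finset.induction_on with
  | empty => simpa using SmallSet.of_finite Set.finite_empty
  | insert i s hi ih =>
    rw [Finset.set_biUnion_insert]
    exact (h i (by simp)).union (ih (fun j hj => h j (by simp [hj])))

theorem small_nat_poly (P : Polynomial ℤ) (hP : 2 ≤ P.natDegree) (C : ℤ) (hC : C ≠ 0) :
    SmallSet {n : ℕ | ∃ s : ℕ, P.eval (s:ℤ) = C * n} := by
  set Q : Polynomial ℝ := P.map (Int.castRingHom ℝ) with hQ
  have hdeg : Q.natDegree = P.natDegree := Polynomial.natDegree_map_eq_of_injective Int.cast_injective P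
  have hQe : ∀ s : ℕ, Q.eval (s:ℝ) = ((P.eval (s:ℤ) : ℤ) : ℝ) := by
    intro s
    have := Polynomial.eval_intCast_map (Int.castRingHom ℝ) P (s:ℤ)
    simpa [hQ] using this
  have hO : (fun x : ℝ => (Polynomial.X ^ 2 : Polynomial ℝ).eval x) =O[Filter.atTop] fun x => Q.eval x := by
    apply Polynomial.isBigO_atTop_of_degree_le
    rw [Polynomial.degree_X_pow]
    have hne : Q ≠ 0 := by rintro h; rw [h] at hdeg; simp at hdeg; omega
    rw [Polynomial.degree_eq_natDegree hne, hdeg]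
    exact_mod_cast hP
  have hO2 : (fun s : ℕ => ((s:ℝ))^2) =O[Filter.atTop] fun s : ℕ => Q.eval (s:ℝ) := by
    simpa [Function.comp_def] using hO.comp_tendsto tendsto_natCast_atTop_atTop
  have hO3 : (fun s : ℕ => (Q.eval (s:ℝ))⁻¹) =O[Filter.atTop] fun s : ℕ => (((s:ℝ))^2)⁻¹ := by
    apply hO2.inv_rev
    filter_upwards [Filter.eventually_gt_atTop 0] with s hs h
    have : (0:ℝ) < s := by exact_mod_cast hs
    exact absurd h (by positivity)
  have hsum : Summable (fun s : ℕ => (Q.eval (s:ℝ))⁻¹) :=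
    summable_of_isBigO_nat (Real.summable_nat_pow_inv.2 (by norm_num)) hO3
  unfold SmallSet
  rw [← summable_subtype_iff_indicator]
  choose s hs using fun n : {n : ℕ | ∃ s : ℕ, P.eval (s:ℤ) = C * n} => n.2
  have hinj : Function.Injective s := by
    intro m n h
    have h1 := hs m
    rw [h, hs n] at h1
    have := mul_left_cancel₀ hC h1
    exact Subtype.ext (by exact_mod_cast this.symm)
  have := (hsum.comp_injective hinj).mul_left (C:ℝ)
  refine this.congr (fun n => ?_)
  simp only [Function.comp, hQe, hs]
  have : (C:ℝ) ≠ 0 := by exact_mod_cast hC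
  push_cast
  rw [mul_inv, ← mul_assoc, mul_inv_cancel₀ this]; simp

theorem small_poly (P : Polynomial ℤ) (hP : P.natDegree ≠ 1) (C : ℤ) (hC : C ≠ 0) :
    SmallSet {n : ℕ | ∃ s : ℤ, P.eval s = C * n} := by
  rcases Nat.lt_or_ge P.natDegree 2 with h | h
  · have h0 : P.natDegree = 0 := by omega
    rw [Polynomial.eq_C_of_natDegree_eq_zero h0]
    apply SmallSet.of_finite
    apply Set.Subsingleton.finite
    rintro m ⟨_, hm⟩ n ⟨_, hn⟩
    simp only [Polynomial.eval_C] at hm hn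
    have := mul_left_cancel₀ hC (hm.symm.trans hn)
    exact_mod_cast this
  · have h2 : 2 ≤ (P.comp (-Polynomial.X)).natDegree := by
      rw [Polynomial.natDegree_comp]; simpa using h
    refine ((small_nat_poly P h C hC).union (small_nat_poly _ h2 C hC)).mono ?_
    rintro n ⟨s, hs⟩
    obtain ⟨k, rfl | rfl⟩ := s.eq_nat_or_neg
    · exact Or.inl ⟨k, hs⟩
    · exact Or.inr ⟨k, by simpa using hs⟩

theorem natDegree_ne_one_of_bdd (P : Polynomial ℤ) (D : ℤ) (h : ∀ s : ℤ, D ≤ P.eval s) :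
    P.natDegree ≠ 1 := by
  intro h1
  obtain ⟨a, ha, b, rfl⟩ := Polynomial.natDegree_eq_one.1 h1
  have := h (-a * (|D| + |b| + 1))
  simp at this
  have h2 : 0 < a^2 := by positivity
  nlinarith [neg_abs_le D, le_abs_self b, abs_nonneg D, abs_nonneg b]

theorem small_line (F : MvPolynomial (Fin 2) ℤ) (C D : ℤ) (hC : C ≠ 0)
    (hD : ∀ x y : ℤ, D ≤ eval ![x, y] F) (α β : ℤ) (hαβ : ¬ (α = 0 ∧ β = 0)) (m : ℤ) :
    SmallSet {n : ℕ | ∃ x y : ℤ, α * x + β * y = m ∧ eval ![x, y] F = C * n} := by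
  by_cases hne : ∃ x y : ℤ, α * x + β * y = m
  swap
  · apply (SmallSet.of_finite Set.finite_empty).mono
    rintro n ⟨x, y, h, _⟩
    exact hne ⟨x, y, h⟩
  obtain ⟨x0, y0, h0⟩ := hne
  have hg : Int.gcd α β ≠ 0 := by rwa [Ne, Int.gcd_eq_zero_iff]
  obtain ⟨g, α', β', hg0, hcop, rfl, rfl⟩ : ∃ g α' β' : ℤ, g ≠ 0 ∧ IsCoprime α' β' ∧ α = g * α' ∧ β = g * β' := by
    obtain ⟨m', n', h1, h2, h3⟩ := Int.exists_gcd_one (Nat.pos_of_ne_zero hg)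
    exact ⟨Int.gcd α β, m', n', by exact_mod_cast hg, Int.isCoprime_iff_gcd_eq_one.2 h1, by rw [mul_comm]; exact h2, by rw [mul_comm]; exact h3⟩
  let P : Polynomial ℤ := MvPolynomial.aeval ![Polynomial.C x0 + Polynomial.C β' * Polynomial.X, Polynomial.C y0 - Polynomial.C α' * Polynomial.X] F
  have hP : ∀ s : ℤ, P.eval s = eval ![x0 + β' * s, y0 - α' * s] F := by
    intro s
    have : ((Polynomial.aeval s).comp (MvPolynomial.aeval ![Polynomial.C x0 + Polynomial.C β' * Polynomial.X, Polynomial.C y0 - Polynomial.C α' * Polynomial.X]) : MvPolynomial (Fin 2) ℤ →ₐ[ℤ] ℤ) = MvPolynomial.aeval ![x0 + β' * s, y0 - α' * s] := by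
      apply MvPolynomial.algHom_ext
      intro i
      fin_cases i <;> simp
    have h2 := DFunLike.congr_fun this F
    simpa [P, MvPolynomial.aeval_eq_eval, Polynomial.coe_aeval_eq_eval] using h2
  refine (small_poly P (natDegree_ne_one_of_bdd P D (fun s => by rw [hP]; exact hD _ _)) C hC).mono ?_
  rintro n ⟨x, y, hxy, hn⟩
  have e1 : α' * (x - x0) = - β' * (y - y0) := by
    apply mul_left_cancel₀ hg0
    linear_combination hxy - h0
  have hdvd : β' ∣ x - x0 := by
    apply hcop.symm.dvd_of_dvd_mul_left
    rw [e1]; exact ⟨-(y - y0), by ring⟩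
  by_cases hb : β' = 0
  · subst hb
    have hu : IsUnit α' := isCoprime_zero_right.1 hcop
    obtain ⟨v, hv⟩ := hu.dvd (a := y0 - y)
    refine ⟨v, ?_⟩
    rw [hP, ← hn]
    have hx : x = x0 := by
      rcases mul_eq_zero.1 (e1.trans (by ring : -0 * (y - y0) = 0)) with h | h
      · simp [h] at hu
      · omega
    congr 2
    simp [hx, ← hv]
  · obtain ⟨v, hv⟩ := hdvd
    refine ⟨v, ?_⟩
    rw [hP, ← hn, ← hv]
    have : y - y0 = - (α' * v) := by
      apply mul_left_cancel₀ hb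
      rw [hv] at e1
      linear_combination e1
    rw [show x0 + (x - x0) = x by ring, show y0 - α' * v = y by linarith]

theorem not_cover (F : MvPolynomial (Fin 2) ℤ) (C D : ℤ) (hC : C ≠ 0)
    (hD : ∀ x y : ℤ, D ≤ eval ![x, y] F)
    (hT : ∀ n : ℕ, D ≤ n → ∃ x y : ℤ, eval ![x, y] F = C * n)
    (α β γ δ : ℤ) (hαβ : ¬ (α = 0 ∧ β = 0)) (hγδ : ¬ (γ = 0 ∧ δ = 0)) (K : ℤ)
    (hK : ∀ p : ℕ, p.Prime → K < p → ∀ x y : ℤ, eval ![x, y] F = C * p →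
      |α * x + β * y| ≤ K ∨ |γ * x + δ * y| ≤ K) : False := by
  apply not_summable_one_div_on_primes
  have hl : ∀ α β : ℤ, ¬ (α = 0 ∧ β = 0) →
      SmallSet (⋃ m ∈ Finset.Icc (-K) K, {n : ℕ | ∃ x y : ℤ, α * x + β * y = m ∧ eval ![x, y] F = C * n}) :=
    fun α β h => SmallSet.biUnion _ _ (fun m _ => small_line F C D hC hD α β h m)
  have hfin : SmallSet (Set.Iic (K.toNat + D.toNat)) := SmallSet.of_finite (Set.finite_Iic _)
  refine (hfin.union ((hl α β hαβ).union (hl γ δ hγδ))).mono ?_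
  intro p hp
  by_cases h : p ≤ K.toNat + D.toNat
  · exact Or.inl h
  right
  obtain ⟨x, y, hxy⟩ := hT p (by omega)
  rcases hK p hp (by omega) x y hxy with h1 | h1
  · left
    simp only [Set.mem_iUnion]
    exact ⟨_, Finset.mem_Icc.2 (abs_le.1 h1), x, y, rfl, hxy⟩
  · right
    simp only [Set.mem_iUnion]
    exact ⟨_, Finset.mem_Icc.2 (abs_le.1 h1), x, y, rfl, hxy⟩

/-- A product of two integers dividing `M * p` : one of them is bounded. -/
theorem factor_bound (M : ℤ) (hM : M ≠ 0) (p : ℕ) (hp : p.Prime) (hpM : |M| < p) (u v w : ℤ)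
    (h : u * v * w = M * p) : |u| ≤ |M| ∨ |v| ≤ |M| := by
  have hpi : Prime (p : ℤ) := Nat.prime_iff_prime_int.1 hp
  have hp0 : (p : ℤ) ≠ 0 := hpi.ne_zero
  have key : ∀ u z : ℤ, ¬ (p:ℤ) ∣ u → u * z = M * p → |u| ≤ |M| := by
    intro u z hu hz
    rcases hpi.dvd_or_dvd (show (p:ℤ) ∣ u * z from ⟨M, by rw [hz]; ring⟩) with h1 | ⟨k, rfl⟩
    · exact absurd h1 hu
    · have : u * k = M := by
        apply mul_right_cancel₀ hp0
        linear_combination hz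
      exact Int.le_of_dvd (abs_pos.2 hM) (by rw [abs_dvd_abs]; exact ⟨k, this.symm⟩)
  by_cases hu : (p:ℤ) ∣ u
  · by_cases hv : (p:ℤ) ∣ v
    · exfalso
      obtain ⟨a, rfl⟩ := hu
      obtain ⟨b, rfl⟩ := hv
      have h2 : (p:ℤ) * (a * b * w) = M := by
        apply mul_right_cancel₀ hp0
        linear_combination h
      have := Int.le_of_dvd (abs_pos.2 hM) (by rw [dvd_abs]; exact ⟨_, h2.symm⟩ : (p:ℤ) ∣ |M|)
      omega
    · exact Or.inr (key v (u * w) hv (by rw [← h]; ring))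
  · exact Or.inl (key u (v * w) hu (by rw [← h]; ring))

theorem case_split (F : MvPolynomial (Fin 2) ℤ) (C D : ℤ) (hC : C ≠ 0)
    (hD : ∀ x y : ℤ, D ≤ eval ![x, y] F)
    (hT : ∀ n : ℕ, D ≤ n → ∃ x y : ℤ, eval ![x, y] F = C * n)
    (α β γ δ : ℤ) (hαβ : ¬ (α = 0 ∧ β = 0)) (hγδ : ¬ (γ = 0 ∧ δ = 0)) (k : ℤ) (hk : k ≠ 0)
    (G : ℤ → ℤ → ℤ)
    (hF : ∀ x y : ℤ, k * eval ![x, y] F = (α * x + β * y) * (γ * x + δ * y) * G x y) : False := by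
  refine not_cover F C D hC hD hT α β γ δ hαβ hγδ |k * C| ?_
  intro p hp hpK x y hxy
  apply factor_bound (k * C) (mul_ne_zero hk hC) p hp hpK _ _ (G x y)
  rw [← hF, hxy]; ring

theorem pell_large (d : ℤ) (hd : 0 < d) (hsq : ¬ IsSquare d) (N : ℕ) :
    ∃ t u : ℤ, t ^ 2 - d * u ^ 2 = 1 ∧ 1 ≤ t ∧ 1 ≤ u ∧ (N:ℤ) ≤ u := by
  induction N with
  | zero =>
    obtain ⟨t, u, h, hu⟩ := Pell.exists_of_not_isSquare hd hsq
    have ht : t ≠ 0 := by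
      rintro rfl
      nlinarith [sq_nonneg u, mul_nonneg hd.le (sq_nonneg u)]
    refine ⟨|t|, |u|, by simpa using h, Int.one_le_abs ht, Int.one_le_abs hu, by simp⟩
  | succ N ih =>
    obtain ⟨t, u, h, ht, hu, hN⟩ := ih
    refine ⟨t ^ 2 + d * u ^ 2, 2 * t * u, ?_, ?_, ?_, ?_⟩
    · linear_combination (t ^ 2 - d * u ^ 2 + 1) * h
    · nlinarith [mul_nonneg hd.le (sq_nonneg u)]
    · nlinarith
    · push_cast; nlinarith

theorem isSquare_of_mul (d m n : ℤ) (hm : m ≠ 0) (h : m ^ 2 * d = n ^ 2) : IsSquare d := by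
  have : m ∣ n := (Int.pow_dvd_pow_iff two_ne_zero).1 ⟨d, h.symm⟩
  obtain ⟨k, rfl⟩ := this
  refine ⟨k, mul_left_cancel₀ (pow_ne_zero 2 hm) ?_⟩
  linear_combination h

/-- Indefinite irreducible: the second form is proportional to the first. -/
theorem proportional (a b c A B E : ℤ) (hd : 0 < b ^ 2 - 4 * a * c)
    (hsq : ¬ IsSquare (b ^ 2 - 4 * a * c)) (ha : a ≠ 0)
    (hpsd : ∀ x y : ℝ, 0 ≤ (a * x ^ 2 + b * x * y + c * y ^ 2) * (A * x ^ 2 + B * x * y + E * y ^ 2)) :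
    a * B = A * b ∧ a * E = A * c := by
  set d := b ^ 2 - 4 * a * c with hdd
  have hdR : (0:ℝ) < (d:ℝ) := by exact_mod_cast hd
  set r := Real.sqrt d with hr
  have hr2 : r ^ 2 = d := Real.sq_sqrt hdR.le
  have hrpos : 0 < r := Real.sqrt_pos.2 hdR
  have haR : (a:ℝ) ≠ 0 := by exact_mod_cast ha
  set θ : ℝ := (-b + r) / (2 * a) with hθ
  have hθ1 : 2 * a * θ = -b + r := by rw [hθ]; field_simp
  have hdd' : (d:ℝ) = b ^ 2 - 4 * a * c := by rw [hdd]; push_cast; ring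
  have hroot : a * θ ^ 2 + b * θ + c = 0 := by
    have : 4 * a * (a * θ ^ 2 + b * θ + c) = 0 := by
      have : 4 * a * (a * θ ^ 2 + b * θ + c) = (2 * a * θ + b) ^ 2 - d := by rw [hdd']; ring
      rw [this, hθ1, ← hr2]; ring
    simpa [haR] using this
  have hder1 : HasDerivAt (fun x : ℝ => a * x ^ 2 + b * x + c) (2 * a * θ + b) θ := by
    have := (((hasDerivAt_pow 2 θ).const_mul (a:ℝ)).add ((hasDerivAt_id θ).const_mul (b:ℝ))).add_const (c:ℝ)
    convert! this using 1
    simp; ring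
  have hder2 : HasDerivAt (fun x : ℝ => A * x ^ 2 + B * x + E) (2 * A * θ + B) θ := by
    have := (((hasDerivAt_pow 2 θ).const_mul (A:ℝ)).add ((hasDerivAt_id θ).const_mul (B:ℝ))).add_const (E:ℝ)
    convert! this using 1
    simp; ring
  have hmin : IsLocalMin ((fun x : ℝ => a * x ^ 2 + b * x + c) * (fun x : ℝ => A * x ^ 2 + B * x + E)) θ := by
    apply Filter.Eventually.of_forall
    intro x
    have := hpsd x 1
    simp only [Pi.mul_apply, hroot, zero_mul]
    simpa using this
  have h0 := hmin.hasDerivAt_eq_zero (hder1.mul hder2)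
  rw [hroot, hθ1, zero_mul, add_zero] at h0
  have h1 : A * θ ^ 2 + B * θ + E = 0 := by
    rcases mul_eq_zero.1 h0 with h | h
    · linarith
    · exact h
  have h2 : ((a * B - A * b : ℤ):ℝ) * r = ((a * B - A * b) * b - 2 * a * (a * E - A * c) : ℤ) := by
    push_cast
    have : r = 2 * a * θ + b := by linarith
    rw [this]
    linear_combination 2 * a * a * h1 - 2 * a * A * hroot
  have h3 : (a * B - A * b) ^ 2 * d = ((a * B - A * b) * b - 2 * a * (a * E - A * c)) ^ 2 := by
    have : (((a * B - A * b : ℤ):ℝ) * r) ^ 2 = (((a * B - A * b) * b - 2 * a * (a * E - A * c) : ℤ):ℝ) ^ 2 := by rw [h2]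
    rw [mul_pow, hr2] at this
    exact_mod_cast this
  have h4 : a * B - A * b = 0 := by
    by_contra hne
    exact hsq (isSquare_of_mul _ _ _ hne h3)
  rw [h4] at h3
  have h5 : a * (a * E - A * c) = 0 := by
    have : (2 * (a * (a * E - A * c))) ^ 2 = 0 := by linear_combination -h3
    have := pow_eq_zero_iff (two_ne_zero) |>.1 this
    omega
  rcases mul_eq_zero.1 h5 with h | h
  · exact absurd h ha
  · constructor <;> omega

theorem case_indef (F : MvPolynomial (Fin 2) ℤ) (C D : ℤ) (hC : C ≠ 0)
    (hD : ∀ x y : ℤ, D ≤ eval ![x, y] F)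
    (hT : ∀ n : ℕ, D ≤ n → ∃ x y : ℤ, eval ![x, y] F = C * n)
    (a b c A B E e f g : ℤ)
    (hF : ∀ x y : ℤ, eval ![x, y] F = (a * x ^ 2 + b * x * y + c * y ^ 2) *
      (A * x ^ 2 + B * x * y + E * y ^ 2 + e * x + f * y + g))
    (hABE : ¬ (A = 0 ∧ B = 0 ∧ E = 0))
    (hd : 0 < b ^ 2 - 4 * a * c)
    (hsq : ¬ IsSquare (b ^ 2 - 4 * a * c))
    (hpsd : ∀ x y : ℝ, 0 ≤ (a * x ^ 2 + b * x * y + c * y ^ 2) * (A * x ^ 2 + B * x * y + E * y ^ 2)) :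
    False := by
  have ha : a ≠ 0 := by
    rintro rfl
    exact hsq ⟨b, by ring⟩
  obtain ⟨hB, hE⟩ := proportional a b c A B E hd hsq ha hpsd
  have hA : A ≠ 0 := by
    rintro rfl
    simp [ha] at hB hE
    exact hABE ⟨rfl, hB, hE⟩
  by_cases hef : e = 0 ∧ f = 0
  · obtain ⟨rfl, rfl⟩ := hef
    let q : Polynomial ℤ := Polynomial.C A * Polynomial.X ^ 2 + Polynomial.C (a * g) * Polynomial.X + Polynomial.C 0
    have hq : q.natDegree = 2 := Polynomial.natDegree_quadratic hA
    have hsm := small_poly q (by omega) (a * C) (mul_ne_zero ha hC)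
    apply not_summable_one_div_on_primes
    refine (hsm.union (SmallSet.of_finite (Set.finite_Iic D.toNat))).mono ?_
    intro p hp
    by_cases h : p ≤ D.toNat
    · exact Or.inr h
    left
    obtain ⟨x, y, hxy⟩ := hT p (by omega)
    refine ⟨a * x ^ 2 + b * x * y + c * y ^ 2, ?_⟩
    rw [mul_assoc a C, ← hxy, hF]
    simp only [q, Polynomial.eval_add, Polynomial.eval_mul, Polynomial.eval_pow, Polynomial.eval_C, Polynomial.eval_X]
    linear_combination -(a * x ^ 2 + b * x * y + c * y ^ 2) * (x * y * hB + y ^ 2 * hE)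
  · have _hd := hd
    set k := 2 * a * f - e * b with hk
    have hek : 1 ≤ |e| + |k| := by
      by_contra hlt
      have h1 : |e| = 0 := by linarith [abs_nonneg e, abs_nonneg k, Int.lt_add_one_iff.1 (not_le.1 hlt : |e| + |k| < 0 + 1)]
      have h2 : |k| = 0 := by linarith [abs_nonneg e, abs_nonneg k, Int.lt_add_one_iff.1 (not_le.1 hlt : |e| + |k| < 0 + 1)]
      rw [abs_eq_zero] at h1 h2
      rw [h1] at hk
      rw [hk] at h2
      simp [ha] at h2
      exact hef ⟨h1, h2⟩
    obtain ⟨t, u, htu, ht, hu, hN⟩ := pell_large _ hd hsq ((|a * A + g * a| + |D| + 1).toNat)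
    have hN' : |a * A + g * a| + |D| + 1 ≤ u := le_trans (Int.self_le_toNat _) hN
    have hval : ∀ t u : ℤ, t ^ 2 - (b ^ 2 - 4 * a * c) * u ^ 2 = 1 →
        D ≤ a * A + g * a + a * (e * t + k * u) := by
      intro t u htu
      have h1 := hD (t - b * u) (2 * a * u)
      rw [hF] at h1
      have hH : a * (t - b * u) ^ 2 + b * (t - b * u) * (2 * a * u) + c * (2 * a * u) ^ 2 = a := by
        linear_combination a * htu
      have hG : a * (A * (t - b * u) ^ 2 + B * (t - b * u) * (2 * a * u) + E * (2 * a * u) ^ 2) = a * A := by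
        linear_combination (t - b * u) * (2 * a * u) * hB + (2 * a * u) ^ 2 * hE + A * hH
      rw [hH] at h1
      refine h1.trans_eq ?_
      rw [hk]
      linear_combination hG
    have v1 := hval t u htu
    have v2 := hval t (-u) (by linear_combination htu)
    have v3 := hval (-t) u (by linear_combination htu)
    have v4 := hval (-t) (-u) (by linear_combination htu)
    have hbig : u ≤ |a| * (|e| * t + |k| * u) := by
      have a1 : 1 ≤ |a| := Int.one_le_abs ha
      have h2 : u ≤ |e| * t + |k| * u := by
        by_cases he : e = 0
        · have : 1 ≤ |k| := by simpa [he] using hek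
          rw [he]; simp; nlinarith
        · have := Int.one_le_abs he
          have hut : u ≤ t := by nlinarith
          nlinarith [abs_nonneg k, mul_nonneg (abs_nonneg k) (by linarith : 0 ≤ u)]
      nlinarith
    have hbig2 : D ≤ a * A + g * a - |a| * (|e| * t + |k| * u) := by
      rcases abs_cases a with ⟨h1, _⟩ | ⟨h1, _⟩ <;> rcases abs_cases e with ⟨h2, _⟩ | ⟨h2, _⟩ <;>
        rcases abs_cases k with ⟨h3, _⟩ | ⟨h3, _⟩ <;> rw [h1, h2, h3] <;>
        first | linarith only [v1] | linarith only [v2] | linarith only [v3] | linarith only [v4]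
    linarith [le_abs_self (a * A + g * a), neg_abs_le D]

theorem conic_lines (A B E e f g : ℤ) (hA : 0 < A) (hδ : 0 ≤ 4 * A * E - B ^ 2) :
    (∃ γ δ : ℤ, ¬ (γ = 0 ∧ δ = 0) ∧ ∀ C : ℤ, ∃ K : ℤ, ∀ x y : ℤ,
      |A * x ^ 2 + B * x * y + E * y ^ 2 + e * x + f * y + g| ≤ C → |γ * x + δ * y| ≤ K) ∨
    (∀ N : ℤ, ∃ x y : ℤ, ¬ (x = 0 ∧ y = 0) ∧
      A * x ^ 2 + B * x * y + E * y ^ 2 + e * x + f * y + g < N) := by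
  set d := 4 * A * E - B ^ 2 with hd
  set κ := 4 * A * f - 2 * B * e with hκ
  set l := 4 * A * g - e ^ 2 with hl
  have key : ∀ x y : ℤ, 4 * A * (A * x ^ 2 + B * x * y + E * y ^ 2 + e * x + f * y + g) =
      (2 * A * x + B * y + e) ^ 2 + d * y ^ 2 + κ * y + l := by
    intro x y; rw [hd, hκ, hl]; ring
  have up : ∀ C x y : ℤ, |A * x ^ 2 + B * x * y + E * y ^ 2 + e * x + f * y + g| ≤ C →
      (2 * A * x + B * y + e) ^ 2 + d * y ^ 2 + κ * y + l ≤ 4 * A * C := by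
    intro C x y h
    rw [← key]
    exact mul_le_mul_of_nonneg_left ((le_abs_self _).trans h) (by linarith)
  rcases hδ.lt_or_eq with hpos | hzero
  · left
    refine ⟨0, 1, by simp, fun C => ⟨|κ| + |l| + |4 * A * C| + 1, fun x y h => ?_⟩⟩
    have h1 := up C x y h
    rw [show 0 * x + 1 * y = y by ring]
    by_contra hlt
    push Not at hlt
    have h2 : |y| ^ 2 ≤ d * y ^ 2 := by rw [sq_abs]; nlinarith [sq_nonneg y]
    have h3 : -(|κ| * |y|) ≤ κ * y := by rw [← abs_mul]; exact neg_abs_le _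
    have h4 := neg_abs_le l
    have h5 := le_abs_self (4 * A * C)
    have h6 := sq_nonneg (2 * A * x + B * y + e)
    have h7 := abs_nonneg κ
    have h8 := abs_nonneg l
    have h9 := abs_nonneg (4 * A * C)
    have h10 : |y| * (|κ| + |l| + |4 * A * C| + 1) ≤ |y| * |y| := mul_le_mul_of_nonneg_left hlt.le (abs_nonneg y)
    have h11 : 1 ≤ |y| := by linarith
    nlinarith
  · rw [← hzero] at key up
    by_cases hk : κ = 0
    · left
      refine ⟨2 * A, B, by omega, fun C => ⟨|l| + |4 * A * C| + |e|, fun x y h => ?_⟩⟩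
      have h1 := up C x y h
      rw [hk] at h1
      have h2 : |2 * A * x + B * y + e| ≤ (2 * A * x + B * y + e) ^ 2 := by
        rw [← sq_abs]
        exact Int.le_self_sq _
      have h3 : |2 * A * x + B * y| ≤ |2 * A * x + B * y + e| + |e| := by
        have := abs_sub (2 * A * x + B * y + e) e
        simpa using this
      linarith [neg_abs_le l, le_abs_self (4 * A * C)]
    · right
      intro N
      set M := |e ^ 2 + l| + |4 * A * N| + 1 with hM
      have hMpos : 0 < M := by positivity
      refine ⟨-B * (-κ * M), 2 * A * (-κ * M), ?_, ?_⟩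
      · rintro ⟨_, h⟩
        simp [hA.ne', hk, hMpos.ne'] at h
      · have h1 := key (-B * (-κ * M)) (2 * A * (-κ * M))
        have h2 : 0 < κ ^ 2 := by positivity
        have h3 : M ≤ 2 * A * κ ^ 2 * M := by
          have : 1 ≤ 2 * A * κ ^ 2 := by nlinarith
          nlinarith
        have h4 : 4 * A * (A * (-B * (-κ * M)) ^ 2 + B * (-B * (-κ * M)) * (2 * A * (-κ * M)) + E * (2 * A * (-κ * M)) ^ 2 +
            e * (-B * (-κ * M)) + f * (2 * A * (-κ * M)) + g) < 4 * A * N := by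
          rw [h1]
          have : (2 * A * (-B * (-κ * M)) + B * (2 * A * (-κ * M)) + e) ^ 2 + 0 * (2 * A * (-κ * M)) ^ 2 +
            κ * (2 * A * (-κ * M)) + l = e ^ 2 + l - 2 * A * κ ^ 2 * M := by ring
          rw [this]
          linarith [le_abs_self (e ^ 2 + l), neg_abs_le (4 * A * N)]
        exact lt_of_mul_lt_mul_left h4 (by linarith)

theorem case_def (F : MvPolynomial (Fin 2) ℤ) (C D : ℤ) (hC : C ≠ 0)
    (hD : ∀ x y : ℤ, D ≤ eval ![x, y] F)
    (hT : ∀ n : ℕ, D ≤ n → ∃ x y : ℤ, eval ![x, y] F = C * n)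
    (a b c A B E e f g : ℤ)
    (hF : ∀ x y : ℤ, eval ![x, y] F = (a * x ^ 2 + b * x * y + c * y ^ 2) *
      (A * x ^ 2 + B * x * y + E * y ^ 2 + e * x + f * y + g))
    (hABE : ¬ (A = 0 ∧ B = 0 ∧ E = 0))
    (hd : b ^ 2 - 4 * a * c < 0) (ha : 0 < a)
    (hpsd : ∀ x y : ℝ, 0 ≤ (a * x ^ 2 + b * x * y + c * y ^ 2) * (A * x ^ 2 + B * x * y + E * y ^ 2)) :
    False := by
  have hHpos : ∀ x y : ℤ, ¬ (x = 0 ∧ y = 0) → 0 < a * x ^ 2 + b * x * y + c * y ^ 2 := by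
    intro x y hxy
    have h1 : 0 < 4 * a * (a * x ^ 2 + b * x * y + c * y ^ 2) := by
      have : 4 * a * (a * x ^ 2 + b * x * y + c * y ^ 2) = (2 * a * x + b * y) ^ 2 + (4 * a * c - b ^ 2) * y ^ 2 := by ring
      rw [this]
      by_cases hy : y = 0
      · subst hy
        have hx : x ≠ 0 := fun h => hxy ⟨h, rfl⟩
        have : 0 < (2 * a * x + b * 0) ^ 2 := by
          have : 2 * a * x + b * 0 ≠ 0 := by simp [ha.ne', hx]
          positivity
        linarith
      · have : 0 < y ^ 2 := by positivity
        have := mul_pos (by linarith : 0 < 4 * a * c - b ^ 2) this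
        nlinarith [sq_nonneg (2 * a * x + b * y)]
    exact pos_of_mul_pos_right h1 (by linarith)
  have hG2 : ∀ x y : ℤ, 0 ≤ A * x ^ 2 + B * x * y + E * y ^ 2 := by
    intro x y
    by_cases hxy : x = 0 ∧ y = 0
    · simp [hxy.1, hxy.2]
    have h1 := hpsd x y
    have h2 : 0 ≤ (a * x ^ 2 + b * x * y + c * y ^ 2) * (A * x ^ 2 + B * x * y + E * y ^ 2) := by
      exact_mod_cast h1
    exact nonneg_of_mul_nonneg_right h2 (hHpos x y hxy)
  have hA0 : 0 ≤ A := by simpa using hG2 1 0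
  have hE0 : 0 ≤ E := by simpa using hG2 0 1
  have hlines : (∃ γ δ : ℤ, ¬ (γ = 0 ∧ δ = 0) ∧ ∀ C : ℤ, ∃ K : ℤ, ∀ x y : ℤ,
      |A * x ^ 2 + B * x * y + E * y ^ 2 + e * x + f * y + g| ≤ C → |γ * x + δ * y| ≤ K) ∨
    (∀ N : ℤ, ∃ x y : ℤ, ¬ (x = 0 ∧ y = 0) ∧
      A * x ^ 2 + B * x * y + E * y ^ 2 + e * x + f * y + g < N) := by
    rcases hA0.lt_or_eq with hA | hA
    · apply conic_lines A B E e f g hA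
      have := hG2 (-B) (2 * A)
      have h2 : 0 ≤ A * (4 * A * E - B ^ 2) := by nlinarith
      exact nonneg_of_mul_nonneg_right h2 hA
    · subst hA
      have hE : 0 < E := by
        rcases hE0.lt_or_eq with h | h
        · exact h
        · subst h
          have h1 := hG2 1 1
          have h2 := hG2 1 (-1)
          exact absurd ⟨rfl, by linarith, rfl⟩ hABE
      have hB : 0 ≤ 4 * E * 0 - B ^ 2 := by
        have := hG2 (2 * E) (-B)
        have h2 : 0 ≤ E * (4 * E * 0 - B ^ 2) := by nlinarith
        exact nonneg_of_mul_nonneg_right h2 hE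
      rcases conic_lines E B 0 f e g hE hB with ⟨γ, δ, h1, h2⟩ | h
      · refine Or.inl ⟨δ, γ, by tauto, fun C => ?_⟩
        obtain ⟨K, hK⟩ := h2 C
        refine ⟨K, fun x y h => ?_⟩
        rw [add_comm]
        apply hK y x
        refine le_trans (le_of_eq ?_) h
        congr 1; ring
      · refine Or.inr fun N => ?_
        obtain ⟨x, y, h1, h2⟩ := h N
        exact ⟨y, x, by tauto, lt_of_le_of_lt (le_of_eq (by ring)) h2⟩
  rcases hlines with ⟨γ, δ, hγδ, hl⟩ | hneg
  · obtain ⟨K, hK⟩ := hl |C|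
    refine not_cover F C D hC hD hT 0 1 γ δ (by simp) hγδ (|K| + |C| + 4 * a * |C|) ?_
    intro p hp _ x y hxy
    have hpi : Prime (p : ℤ) := Nat.prime_iff_prime_int.1 hp
    have hp0 : (p : ℤ) ≠ 0 := hpi.ne_zero
    have hx := hF x y
    rw [hxy] at hx
    have hac : 0 ≤ 4 * a * |C| := by positivity
    rcases hpi.dvd_or_dvd (show (p:ℤ) ∣ _ * _ from ⟨C, by rw [← hx]; ring⟩) with ⟨k, h1⟩ | ⟨k, h1⟩
    · right
      have h2 : k * (A * x ^ 2 + B * x * y + E * y ^ 2 + e * x + f * y + g) = C := by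
        apply mul_right_cancel₀ hp0
        rw [hx, h1]; ring
      have h3 := hK x y (Int.le_of_dvd (abs_pos.2 hC) (by rw [abs_dvd_abs]; exact ⟨k, by rw [← h2]; ring⟩))
      linarith [le_abs_self K, abs_nonneg C]
    · left
      have h2 : (a * x ^ 2 + b * x * y + c * y ^ 2) * k = C := by
        apply mul_right_cancel₀ hp0
        rw [hx, h1]; ring
      have h3 := Int.le_of_dvd (abs_pos.2 hC) (show a * x ^ 2 + b * x * y + c * y ^ 2 ∣ |C| by
        rw [dvd_abs]; exact ⟨k, h2.symm⟩)
      have h4 : |y| ≤ 4 * a * |C| := by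
        have h5 : |y| ≤ y ^ 2 := by rw [← sq_abs]; exact Int.le_self_sq _
        have h6 := mul_le_mul_of_nonneg_left h3 (by linarith : 0 ≤ 4 * a)
        have h7 : y ^ 2 ≤ (4 * a * c - b ^ 2) * y ^ 2 := by nlinarith [sq_nonneg y]
        nlinarith [sq_nonneg (2 * a * x + b * y)]
      rw [show 0 * x + 1 * y = y by ring]
      linarith [abs_nonneg K, abs_nonneg C]
  · obtain ⟨x, y, hxy, h⟩ := hneg (-|D| - 1)
    have h1 := hHpos x y hxy
    have h2 := hD x y
    rw [hF] at h2
    nlinarith [neg_abs_le D, abs_nonneg D]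

theorem core (F : MvPolynomial (Fin 2) ℤ) (C D : ℤ) (hC : C ≠ 0)
    (hD : ∀ x y : ℤ, D ≤ eval ![x, y] F)
    (hT : ∀ n : ℕ, D ≤ n → ∃ x y : ℤ, eval ![x, y] F = C * n)
    (a b c A B E e f g : ℤ)
    (hF : ∀ x y : ℤ, eval ![x, y] F = (a * x ^ 2 + b * x * y + c * y ^ 2) *
      (A * x ^ 2 + B * x * y + E * y ^ 2 + e * x + f * y + g))
    (habc : ¬ (a = 0 ∧ b = 0 ∧ c = 0))
    (hABE : ¬ (A = 0 ∧ B = 0 ∧ E = 0))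
    (hpsd : ∀ x y : ℝ, 0 ≤ (a * x ^ 2 + b * x * y + c * y ^ 2) * (A * x ^ 2 + B * x * y + E * y ^ 2)) :
    False := by
  by_cases hsq : IsSquare (b ^ 2 - 4 * a * c)
  · by_cases ha : a = 0
    · subst ha
      refine case_split F C D hC hD hT 0 1 b c (by simp) (by tauto) 1 one_ne_zero
        (fun x y => A * x ^ 2 + B * x * y + E * y ^ 2 + e * x + f * y + g) ?_
      intro x y
      rw [hF]; ring
    · obtain ⟨r, hr⟩ := hsq
      refine case_split F C D hC hD hT (2 * a) (b + r) (2 * a) (b - r) (by omega) (by omega) (4 * a) (by omega)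
        (fun x y => A * x ^ 2 + B * x * y + E * y ^ 2 + e * x + f * y + g) ?_
      intro x y
      rw [hF]
      linear_combination -y ^ 2 * (A * x ^ 2 + B * x * y + E * y ^ 2 + e * x + f * y + g) * hr
  · rcases lt_trichotomy (b ^ 2 - 4 * a * c) 0 with h | h | h
    · rcases lt_trichotomy a 0 with ha | ha | ha
      · refine case_def F C D hC hD hT (-a) (-b) (-c) (-A) (-B) (-E) (-e) (-f) (-g) ?_ (by omega) (by nlinarith) (by linarith) ?_
        · intro x y; rw [hF]; ring
        · intro x y
          have := hpsd x y
          push_cast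
          linarith
      · subst ha; nlinarith [sq_nonneg b]
      · exact case_def F C D hC hD hT a b c A B E e f g hF hABE h ha hpsd
    · exact absurd (by rw [h]; exact ⟨0, rfl⟩) hsq
    · exact case_indef F C D hC hD hT a b c A B E e f g hF hABE h hsq hpsd

noncomputable def quadForm (a b c : ℤ) : MvPolynomial (Fin 2) ℤ :=
  MvPolynomial.C a * X 0 ^ 2 + MvPolynomial.C b * (X 0 * X 1) + MvPolynomial.C c * X 1 ^ 2

theorem homog_two (H : MvPolynomial (Fin 2) ℤ) (hH : H.IsHomogeneous 2) :
    ∃ a b c : ℤ, H = quadForm a b c := by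
  refine ⟨coeff (Finsupp.single 0 2) H, coeff (Finsupp.single 0 1 + Finsupp.single 1 1) H, coeff (Finsupp.single 1 2) H, ?_⟩
  have hq : (quadForm (coeff (Finsupp.single 0 2) H) (coeff (Finsupp.single 0 1 + Finsupp.single 1 1) H) (coeff (Finsupp.single 1 2) H)) =
     monomial (Finsupp.single 0 2) (coeff (Finsupp.single 0 2) H) +
     monomial (Finsupp.single 0 1 + Finsupp.single 1 1) (coeff (Finsupp.single 0 1 + Finsupp.single 1 1) H) +
     monomial (Finsupp.single 1 2) (coeff (Finsupp.single 1 2) H) := by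
    simp [quadForm, monomial_eq, Finsupp.prod_add_index', pow_add]
  rw [hq]
  ext m
  simp only [coeff_add, coeff_monomial]
  have hm : ∀ n : Fin 2 →₀ ℕ, n = m ↔ n 0 = m 0 ∧ n 1 = m 1 := by
    intro n; constructor
    · rintro rfl; simp
    · rintro ⟨h1, h2⟩; ext i; fin_cases i <;> simpa
  by_cases h0 : coeff m H = 0
  · have hz : ∀ n, (if n = m then coeff n H else 0) = 0 := by
      intro n
      split_ifs with h
      · rw [h, h0]
      · rfl
    rw [h0, hz, hz, hz]; rfl
  · have hdeg := hH h0
    rw [Finsupp.weight_apply, Finsupp.sum_fintype _ _ (by simp)] at hdeg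
    simp [Fin.sum_univ_two] at hdeg
    have h3 : (m 0 = 0 ∧ m 1 = 2) ∨ (m 0 = 1 ∧ m 1 = 1) ∨ (m 0 = 2 ∧ m 1 = 0) := by omega
    rcases h3 with ⟨h1, h2⟩ | ⟨h1, h2⟩ | ⟨h1, h2⟩
    · have : m = Finsupp.single 1 2 := ((hm _).2 (by simp [h1, h2])).symm
      subst this
      simp [Finsupp.ext_iff]
    · have : m = Finsupp.single 0 1 + Finsupp.single 1 1 := ((hm _).2 (by simp [h1, h2])).symm
      subst this
      simp [Finsupp.ext_iff]
    · have : m = Finsupp.single 0 2 := ((hm _).2 (by simp [h1, h2])).symm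
      subst this
      simp [Finsupp.ext_iff]

theorem homog_one (H : MvPolynomial (Fin 2) ℤ) (hH : H.IsHomogeneous 1) :
    ∃ e f : ℤ, H = MvPolynomial.C e * X 0 + MvPolynomial.C f * X 1 := by
  refine ⟨coeff (Finsupp.single 0 1) H, coeff (Finsupp.single 1 1) H, ?_⟩
  have hq : (MvPolynomial.C (coeff (Finsupp.single 0 1) H) * X 0 + MvPolynomial.C (coeff (Finsupp.single 1 1) H) * X 1 : MvPolynomial (Fin 2) ℤ) =
     monomial (Finsupp.single 0 1) (coeff (Finsupp.single 0 1) H) +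
     monomial (Finsupp.single 1 1) (coeff (Finsupp.single 1 1) H) := by
    simp [monomial_eq]
  rw [hq]
  ext m
  simp only [coeff_add, coeff_monomial]
  have hm : ∀ n : Fin 2 →₀ ℕ, n = m ↔ n 0 = m 0 ∧ n 1 = m 1 := by
    intro n; constructor
    · rintro rfl; simp
    · rintro ⟨h1, h2⟩; ext i; fin_cases i <;> simpa
  by_cases h0 : coeff m H = 0
  · have hz : ∀ n, (if n = m then coeff n H else 0) = 0 := by
      intro n
      split_ifs with h
      · rw [h, h0]
      · rfl
    rw [h0, hz, hz]; rfl
  · have hdeg := hH h0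
    rw [Finsupp.weight_apply, Finsupp.sum_fintype _ _ (by simp)] at hdeg
    simp [Fin.sum_univ_two] at hdeg
    have h3 : (m 0 = 0 ∧ m 1 = 1) ∨ (m 0 = 1 ∧ m 1 = 0) := by omega
    rcases h3 with ⟨h1, h2⟩ | ⟨h1, h2⟩
    · have : m = Finsupp.single 1 1 := ((hm _).2 (by simp [h1, h2])).symm
      subst this
      simp [Finsupp.ext_iff]
    · have : m = Finsupp.single 0 1 := ((hm _).2 (by simp [h1, h2])).symm
      subst this
      simp [Finsupp.ext_iff]

/-- **Lemma 6.7.** Suppose `F ∈ ℤ[x,y]` has degree 4, `F(0,0) = 0`,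
the degree-4 part `F₄` is positive semi-definite and `gcd(F̃₄, F₃, F₂, F₁)` has degree 2,
so that `F = H·G` with `H` a primitive integral quadratic form and `G` an integral
quadratic polynomial.  Then `F(ℤ²) ≠ (Cℤ)_{≥D}` for every `C ∈ ℕ`, `D ∈ ℤ`. -/
theorem gcd_degree_two_value_set_ne
    (F : MvPolynomial (Fin 2) ℤ) (hdeg : F.totalDegree = 4)
    (h0 : MvPolynomial.eval ![0, 0] F = 0)
    (hpsd : PosSemidef2 (MvPolynomial.homogeneousComponent 4 F))
    (Ft4 : MvPolynomial (Fin 2) ℤ)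
    (htilde : IsTildePart (MvPolynomial.homogeneousComponent 4 F) Ft4)
    (hgcd : ∃ g : MvPolynomial (Fin 2) ℚ, g.totalDegree = 2 ∧
      g ∣ toQ Ft4 ∧ g ∣ toQ (MvPolynomial.homogeneousComponent 3 F) ∧
      g ∣ toQ (MvPolynomial.homogeneousComponent 2 F) ∧
      g ∣ toQ (MvPolynomial.homogeneousComponent 1 F) ∧
      ∀ e : MvPolynomial (Fin 2) ℚ, e ∣ toQ Ft4 →
        e ∣ toQ (MvPolynomial.homogeneousComponent 3 F) →
        e ∣ toQ (MvPolynomial.homogeneousComponent 2 F) →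
        e ∣ toQ (MvPolynomial.homogeneousComponent 1 F) → e ∣ g)
    (H G : MvPolynomial (Fin 2) ℤ) (hH : H.IsHomogeneous 2) (hHprim : IsPrimitiveInt H)
    (hG : G.totalDegree = 2) (hfac : F = H * G)
    (C : ℤ) (hC : 0 < C) (D : ℤ) :
    valueSet F ≠ targetSet C D := by
  intro heq
  have hD : ∀ x y : ℤ, D ≤ eval ![x, y] F := by
    intro x y
    have h1 : eval ![x, y] F ∈ valueSet F := ⟨x, y, rfl⟩
    rw [heq] at h1
    exact h1.2
  have hT : ∀ n : ℕ, D ≤ n → ∃ x y : ℤ, eval ![x, y] F = C * n := by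
    intro n hn
    have h1 : C * (n:ℤ) ∈ targetSet C D := ⟨⟨n, rfl⟩, by nlinarith⟩
    rw [← heq] at h1
    exact h1
  have hsum : G = homogeneousComponent 0 G + homogeneousComponent 1 G + homogeneousComponent 2 G := by
    have := sum_homogeneousComponent G
    rw [hG] at this
    simpa [Finset.sum_range_succ] using this.symm
  have hG2h := homogeneousComponent_isHomogeneous 2 G
  have hG1h := homogeneousComponent_isHomogeneous 1 G
  have hG0h := homogeneousComponent_isHomogeneous 0 G
  have hF4 : homogeneousComponent 4 F = H * homogeneousComponent 2 G := by
    rw [hfac]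
    conv_lhs => rw [hsum]
    rw [mul_add, mul_add, map_add, map_add, homogeneousComponent_of_mem (hH.mul hG0h),
      homogeneousComponent_of_mem (hH.mul hG1h), homogeneousComponent_of_mem (hH.mul hG2h)]
    simp
  rw [homogeneousComponent_zero] at hsum
  obtain ⟨a, b, c, hHq⟩ := homog_two H hH
  obtain ⟨A, B, E, hGq⟩ := homog_two _ hG2h
  obtain ⟨e, f, hGl⟩ := homog_one _ hG1h
  refine core F C D hC.ne' hD hT a b c A B E e f (coeff 0 G) ?_ ?_ ?_ ?_
  · intro x y
    rw [hGq, hGl] at hsum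
    generalize coeff 0 G = g at hsum ⊢
    rw [hfac, hsum, hHq]
    simp [quadForm]
    ring
  · rintro ⟨rfl, rfl, rfl⟩
    have : F = 0 := by rw [hfac, hHq]; simp [quadForm]
    rw [this] at hdeg
    simp at hdeg
  · rintro ⟨rfl, rfl, rfl⟩
    have h2 : homogeneousComponent 2 G = 0 := by rw [hGq]; simp [quadForm]
    rw [h2, add_zero] at hsum
    have h3 : G.totalDegree ≤ 1 := by
      rw [hsum]
      refine (totalDegree_add _ _).trans (max_le ?_ ?_)
      · rw [totalDegree_C]; omega
      · exact hG1h.totalDegree_le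
    omega
  · intro x y
    have h1 := hpsd x y
    rw [hF4, hGq, hHq] at h1
    simp [evalReal, quadForm] at h1
    linarith
end

section
/- Let F ∈ ℤ[x,y] have total degree 4 with F(0,0) = 0, write F = F_4 + F_3 + F_2 + F_1 with F_i the homogeneous degree-i part, suppose F_4 is positive semi-definite, and suppose the degree of gcd(F̃_4, F_3, F_2, F_1) is 1 or 3, so that after a GL₂(ℤ)-change of variables F(x,y) = (ax + b)·K(x,y) with a a nonzero integer, b an integer, and K a degree-3 primitive integral polynomial. Then for every positive integer C, either #(F(ℤ²) ∩ C℘ ∩ [1,N]) ≪ √N · log N, or the infimum of F(x,y) over (x,y) ∈ ℤ² is −∞. -/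
open MvPolynomial

/-! ### Polynomial functions on the integers which are bounded below -/

theorem aux_neg (n : ℕ) (A S M : ℤ) (g : ℤ → ℤ) (hA : A < 0)
    (hg : ∀ t : ℤ, 1 ≤ t → g t ≤ S * t ^ n)
    (h : ∀ t : ℤ, 1 ≤ t → -M ≤ A * t ^ (n + 1) + g t) : False := by
  have hM := le_abs_self M
  have hM0 := abs_nonneg M
  have hS := le_abs_self S
  have hS0 := abs_nonneg S
  obtain ⟨t, ht⟩ : ∃ t : ℤ, t = |S| + |M| + 1 := ⟨_, rfl⟩
  have ht1 : 1 ≤ t := by linarith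
  have h1 := hg t ht1
  have h2 := h t ht1
  have h3 : 1 ≤ t ^ n := one_le_pow₀ ht1
  rw [pow_succ] at h2
  have h4 : (A + 1) * (t ^ n * t) ≤ 0 :=
    mul_nonpos_of_nonpos_of_nonneg (by linarith) (by positivity)
  have h5 : (S - t) * t ^ n ≤ (-(|M| + 1)) * t ^ n :=
    mul_le_mul_of_nonneg_right (by linarith) (by linarith)
  nlinarith

theorem aux_pow {B t : ℤ} {i n : ℕ} (hin : i ≤ n) (ht : 1 ≤ t) : B * t ^ i ≤ |B| * t ^ n := by
  have h1 : t ^ i ≤ t ^ n := pow_le_pow_right₀ ht hin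
  have h2 : 0 ≤ t ^ i := by positivity
  exact (mul_le_mul_of_nonneg_right (le_abs_self B) h2).trans
    (mul_le_mul_of_nonneg_left h1 (abs_nonneg B))

theorem aux_quartic {A B C D E M : ℤ}
    (h : ∀ t : ℤ, 1 ≤ t → -M ≤ A * t ^ 4 + B * t ^ 3 + C * t ^ 2 + D * t + E) : 0 ≤ A := by
  by_contra hA
  refine aux_neg 3 A (|B| + |C| + |D| + |E|) M
    (fun t => B * t ^ 3 + C * t ^ 2 + D * t + E) (by linarith) ?_ ?_
  · intro t ht
    have h1 := aux_pow (B := B) (show 3 ≤ 3 by norm_num) ht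
    have h2 := aux_pow (B := C) (show 2 ≤ 3 by norm_num) ht
    have h3 := aux_pow (B := D) (show 1 ≤ 3 by norm_num) ht
    have h4 := aux_pow (B := E) (show 0 ≤ 3 by norm_num) ht
    simp only [pow_one, pow_zero, mul_one] at h3 h4
    linarith
  · intro t ht
    have := h t ht
    norm_num
    linarith

theorem aux_cubic {B C D E M : ℤ}
    (h : ∀ t : ℤ, 1 ≤ t → -M ≤ B * t ^ 3 + C * t ^ 2 + D * t + E) : 0 ≤ B := by
  by_contra hA
  refine aux_neg 2 B (|C| + |D| + |E|) M
    (fun t => C * t ^ 2 + D * t + E) (by linarith) ?_ ?_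
  · intro t ht
    have h2 := aux_pow (B := C) (show 2 ≤ 2 by norm_num) ht
    have h3 := aux_pow (B := D) (show 1 ≤ 2 by norm_num) ht
    have h4 := aux_pow (B := E) (show 0 ≤ 2 by norm_num) ht
    simp only [pow_one, pow_zero, mul_one] at h3 h4
    linarith
  · intro t ht
    have := h t ht
    norm_num
    linarith

theorem aux_quad {C D E M : ℤ}
    (h : ∀ t : ℤ, 1 ≤ t → -M ≤ C * t ^ 2 + D * t + E) : 0 ≤ C := by
  by_contra hA
  refine aux_neg 1 C (|D| + |E|) M
    (fun t => D * t + E) (by linarith) ?_ ?_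
  · intro t ht
    have h3 := aux_pow (B := D) (show 1 ≤ 1 by norm_num) ht
    have h4 := aux_pow (B := E) (show 0 ≤ 1 by norm_num) ht
    simp only [pow_one, pow_zero, mul_one] at h3 h4
    simp only [pow_one]
    linarith
  · intro t ht
    have := h t ht
    norm_num
    linarith

theorem aux_lin {D E M : ℤ} (h : ∀ t : ℤ, 1 ≤ t → -M ≤ D * t + E) : 0 ≤ D := by
  by_contra hA
  refine aux_neg 0 D |E| M (fun _ => E) (by linarith) ?_ ?_
  · intro t ht
    have := le_abs_self E
    simpa using this
  · intro t ht
    have := h t ht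
    norm_num
    linarith

theorem aux_cubic_zero {B C D E M : ℤ}
    (h : ∀ t : ℤ, -M ≤ B * t ^ 3 + C * t ^ 2 + D * t + E) : B = 0 := by
  have h1 : 0 ≤ B := aux_cubic (fun t _ => h t)
  have h2 : 0 ≤ -B := aux_cubic (B := -B) (C := C) (D := -D) (E := E) (M := M)
    (fun t _ => by have := h (-t); linarith [this, Even.neg_pow (show Even 2 by decide) t,
        Odd.neg_pow (show Odd 3 by decide) t, show B * (-t)^3 = -B * t^3 by ring,
        show C * (-t)^2 = C * t^2 by ring])
  linarith

theorem aux_lin_zero {D E M : ℤ} (h : ∀ t : ℤ, -M ≤ D * t + E) : D = 0 := by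
  have h1 : 0 ≤ D := aux_lin (fun t _ => h t)
  have h2 : 0 ≤ -D := aux_lin (D := -D) (E := E) (M := M)
    (fun t _ => by have := h (-t); linarith)
  linarith

/-- Ten-coefficient cubic polynomial. -/
def cub (c03 α β γ e g δ f h k x y : ℤ) : ℤ :=
  c03 * y ^ 3 + (α * x + β) * y ^ 2 + (γ * x ^ 2 + e * x + g) * y
    + (δ * x ^ 3 + f * x ^ 2 + h * x + k)

theorem cub_of_totalDegree (K : MvPolynomial (Fin 2) ℤ) (hK : K.totalDegree ≤ 3) :
    ∃ c03 α β γ e g δ f h k : ℤ, ∀ x y : ℤ,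
      MvPolynomial.eval ![x, y] K = cub c03 α β γ e g δ f h k x y := by
  have key : ∀ x y : ℤ, MvPolynomial.eval ![x, y] K =
      (∑ d ∈ K.support, fun x y : ℤ => MvPolynomial.coeff d K * (x ^ d 0 * y ^ d 1)) x y := by
    intro x y
    rw [MvPolynomial.eval_eq']
    simp [Finset.sum_apply]
  have := Finset.sum_induction (s := K.support)
    (fun d => fun x y : ℤ => MvPolynomial.coeff d K * (x ^ d 0 * y ^ d 1))
    (fun φ : ℤ → ℤ → ℤ => ∃ c03 α β γ e g δ f h k : ℤ, ∀ x y : ℤ,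
      φ x y = cub c03 α β γ e g δ f h k x y) ?_ ?_ ?_
  · obtain ⟨c03, α, β, γ, e, g, δ, f, h, k, H⟩ := this
    exact ⟨c03, α, β, γ, e, g, δ, f, h, k, fun x y => (key x y).trans (H x y)⟩
  · rintro φ ψ ⟨c03, α, β, γ, e, g, δ, f, h, k, H⟩ ⟨c03', α', β', γ', e', g', δ', f', h', k', H'⟩
    refine ⟨c03 + c03', α + α', β + β', γ + γ', e + e', g + g', δ + δ', f + f', h + h', k + k', ?_⟩
    intro x y
    simp only [Pi.add_apply, H, H', cub]
    ring
  · exact ⟨0, 0, 0, 0, 0, 0, 0, 0, 0, 0, fun x y => by simp [cub]⟩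
  · intro d hd
    have h1 := (MvPolynomial.le_totalDegree hd).trans hK
    rw [Finsupp.sum_fintype _ _ (by simp)] at h1
    simp only [Fin.sum_univ_two] at h1
    generalize MvPolynomial.coeff d K = c
    generalize d 0 = i at *
    generalize d 1 = j at *
    have hi : i ≤ 3 := by omega
    have hj : j ≤ 3 := by omega
    refine ⟨if i = 0 ∧ j = 3 then c else 0, if i = 1 ∧ j = 2 then c else 0,
      if i = 0 ∧ j = 2 then c else 0, if i = 2 ∧ j = 1 then c else 0,
      if i = 1 ∧ j = 1 then c else 0, if i = 0 ∧ j = 1 then c else 0,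
      if i = 3 ∧ j = 0 then c else 0, if i = 2 ∧ j = 0 then c else 0,
      if i = 1 ∧ j = 0 then c else 0, if i = 0 ∧ j = 0 then c else 0, ?_⟩
    intro x y
    interval_cases i <;> interval_cases j <;> first | omega | (simp [cub]; try ring)

/-- A nonconstant cubic takes each value finitely often. -/
theorem aux_roots (A B D E : ℤ) (hne : ¬ (A = 0 ∧ B = 0 ∧ D = 0 ∧ E = 0)) :
    {x : ℤ | A * x ^ 3 + B * x ^ 2 + D * x + E = 0}.Finite := by
  have hp : (Cubic.mk A B D E).toPoly ≠ 0 := by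
    intro hz
    rw [Cubic.toPoly_eq_zero_iff] at hz
    apply hne
    exact ⟨congrArg Cubic.a hz, congrArg Cubic.b hz, congrArg Cubic.c hz, congrArg Cubic.d hz⟩
  refine (Polynomial.finite_setOfPred_isRoot hp).subset ?_
  intro x hx
  simpa [Polynomial.IsRoot, Cubic.toPoly] using hx

theorem aux_roots_all {A B D E : ℤ} (h : ∀ x : ℤ, A * x ^ 3 + B * x ^ 2 + D * x + E = 0) :
    A = 0 ∧ B = 0 ∧ D = 0 ∧ E = 0 := by
  by_contra hne
  have h1 := aux_roots A B D E hne
  have h2 : {x : ℤ | A * x ^ 3 + B * x ^ 2 + D * x + E = 0} = Set.univ :=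
    Set.eq_univ_of_forall h
  rw [h2] at h1
  exact Set.infinite_univ h1

/-- Facts on the behaviour in the `y`-direction. -/
theorem ydir {a b c03 α β γ e g δ f h k M : ℤ} (ha : a ≠ 0)
    (hb : ∀ x y : ℤ, -M ≤ (a * x + b) * cub c03 α β γ e g δ f h k x y) :
    c03 = 0 ∧ ∀ x : ℤ, 0 ≤ (a * x + b) * (α * x + β) ∧
      ((a * x + b) * (α * x + β) = 0 → (a * x + b) * (γ * x ^ 2 + e * x + g) = 0) := by
  have h1 : ∀ x : ℤ, (a * x + b) * c03 = 0 := fun x =>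
    aux_cubic_zero (B := (a * x + b) * c03) (C := (a * x + b) * (α * x + β))
      (D := (a * x + b) * (γ * x ^ 2 + e * x + g))
      (E := (a * x + b) * (δ * x ^ 3 + f * x ^ 2 + h * x + k)) (M := M)
      (fun y => by have := hb x y; unfold cub at this; linarith)
  have hc : c03 = 0 := by
    have h2 := h1 0
    have h3 := h1 1
    have h4 : a * c03 = 0 := by linarith
    exact (mul_eq_zero.mp h4).resolve_left ha
  refine ⟨hc, fun x => ⟨?_, fun h0 => ?_⟩⟩
  · exact aux_quad (D := (a * x + b) * (γ * x ^ 2 + e * x + g))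
      (E := (a * x + b) * (δ * x ^ 3 + f * x ^ 2 + h * x + k)) (M := M)
      (fun y _ => by have := hb x y; unfold cub at this; rw [hc] at this; linarith)
  · exact aux_lin_zero
      (E := (a * x + b) * (δ * x ^ 3 + f * x ^ 2 + h * x + k)) (M := M)
      (fun y => by
        have h1 := hb x y
        have h2 : (a * x + b) * (α * x + β) * y ^ 2 = 0 := by rw [h0, zero_mul]
        unfold cub at h1; rw [hc] at h1; linarith)

theorem finite_of_bound {S : Set ℤ} (B : ℤ) (h : ∀ x ∈ S, |x| ≤ B) : S.Finite :=
  (Set.finite_Icc (-B) B).subset fun x hx => abs_le.mp (h x hx)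

/-- The definite case. -/
theorem bound_definite {α β D E Φ G H k x z : ℤ} (hα : α ≠ 0) (hD : 0 < D)
    (hK : α * x * (z ^ 2 + D * x ^ 2) + β * z ^ 2 + E * (x * z) + Φ * x ^ 2 + G * z + H * x + k = 0) :
    |x| ≤ |β| + |E| + |Φ| + |G| + |H| + |k| := by
  have n1 := abs_nonneg β
  have n2 := abs_nonneg E
  have n3 := abs_nonneg Φ
  have n4 := abs_nonneg G
  have n5 := abs_nonneg H
  have n6 := abs_nonneg k
  by_cases hx : x = 0
  · rw [hx, abs_zero]; positivity
  have hx1 : 1 ≤ |x| := Int.one_le_abs hx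
  have hα1 : 1 ≤ |α| := Int.one_le_abs hα
  have hx2 : |x| ^ 2 = x ^ 2 := sq_abs x
  have hz2 : |z| ^ 2 = z ^ 2 := sq_abs z
  obtain ⟨T, hT⟩ : ∃ T : ℤ, T = z ^ 2 + x ^ 2 := ⟨_, rfl⟩
  have hxT : |x| ≤ x ^ 2 := by rw [← hx2]; nlinarith
  have hzT : |z| ≤ z ^ 2 := by
    rw [← hz2]
    rcases eq_or_ne z 0 with h | h
    · simp [h]
    · have := Int.one_le_abs h
      nlinarith
  have hxz : |x * z| ≤ T := by
    rw [abs_mul, hT, ← hx2, ← hz2]; nlinarith [sq_nonneg (|x| - |z|), abs_nonneg x, abs_nonneg z]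
  have hzz : 0 ≤ z ^ 2 := sq_nonneg z
  have hTpos : 0 < T := by linarith
  have e1 : |β * z ^ 2| ≤ |β| * T := by
    rw [abs_mul, abs_of_nonneg hzz]; exact mul_le_mul_of_nonneg_left (by linarith) n1
  have e2 : |E * (x * z)| ≤ |E| * T := by
    rw [abs_mul]; exact mul_le_mul_of_nonneg_left hxz n2
  have e3 : |Φ * x ^ 2| ≤ |Φ| * T := by
    rw [abs_mul, abs_of_nonneg (sq_nonneg x)]; exact mul_le_mul_of_nonneg_left (by linarith) n3
  have e4 : |G * z| ≤ |G| * T := by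
    rw [abs_mul]; exact mul_le_mul_of_nonneg_left (by linarith [sq_nonneg x]) n4
  have e5 : |H * x| ≤ |H| * T := by
    rw [abs_mul]; exact mul_le_mul_of_nonneg_left (by linarith) n5
  have e6 : |k| ≤ |k| * T := by nlinarith
  have e0 : |x| * T ≤ |α * x * (z ^ 2 + D * x ^ 2)| := by
    have : T ≤ z ^ 2 + D * x ^ 2 := by nlinarith [sq_nonneg x]
    rw [abs_mul, abs_mul, abs_of_nonneg (by linarith : 0 ≤ z ^ 2 + D * x ^ 2)]
    have h1 : |x| ≤ |α| * |x| := by nlinarith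
    exact mul_le_mul h1 this hTpos.le (by positivity)
  have e7 : |α * x * (z ^ 2 + D * x ^ 2)| ≤
      |β * z ^ 2| + |E * (x * z)| + |Φ * x ^ 2| + |G * z| + |H * x| + |k| := by
    rw [abs_le]
    constructor <;>
    linarith [le_abs_self (β * z ^ 2), neg_abs_le (β * z ^ 2), le_abs_self (E * (x * z)),
      neg_abs_le (E * (x * z)), le_abs_self (Φ * x ^ 2), neg_abs_le (Φ * x ^ 2),
      le_abs_self (G * z), neg_abs_le (G * z), le_abs_self (H * x), neg_abs_le (H * x),
      le_abs_self k, neg_abs_le k]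
  have e8 : |x| * T ≤ (|β| + |E| + |Φ| + |G| + |H| + |k|) * T := by linarith
  exact le_of_mul_le_mul_right e8 hTpos

/-- The degenerate case. -/
theorem bound_degenerate (α β E G H k : ℤ) (hα : α ≠ 0) : ∃ B : ℤ, ∀ x z : ℤ,
    α * z ^ 2 + E * z + H ≠ 0 → x * (α * z ^ 2 + E * z + H) + (β * z ^ 2 + G * z + k) = 0 →
    |x| ≤ B := by
  obtain ⟨S, hS⟩ : ∃ S : ℤ, S = |E| + |H| + 1 := ⟨_, rfl⟩
  obtain ⟨R, hR⟩ : ∃ R : ℤ, R = |β| + |G| + |k| := ⟨_, rfl⟩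
  have n1 := abs_nonneg β
  have n2 := abs_nonneg E
  have n4 := abs_nonneg G
  have n5 := abs_nonneg H
  have n6 := abs_nonneg k
  have hα1 : 1 ≤ |α| := Int.one_le_abs hα
  refine ⟨R * ((2 * S) ^ 2 + 1), fun x z hP h => ?_⟩
  have hz0 := abs_nonneg z
  have hx0 := abs_nonneg x
  have hz2 : |z| ^ 2 = z ^ 2 := sq_abs z
  have hP1 : 1 ≤ |α * z ^ 2 + E * z + H| := Int.one_le_abs hP
  have hxP : |x| * |α * z ^ 2 + E * z + H| = |β * z ^ 2 + G * z + k| := by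
    rw [← abs_mul, ← abs_neg (β * z ^ 2 + G * z + k)]; congr 1; linarith
  have hRz : |β * z ^ 2 + G * z + k| ≤ |β| * |z| ^ 2 + |G| * |z| + |k| := by
    have := abs_add_three (β * z ^ 2) (G * z) k
    rwa [abs_mul, abs_mul, abs_pow] at this
  have hRpos : 0 ≤ R := by linarith
  have hzsq : |z| ≤ |z| ^ 2 := by
    rcases eq_or_ne z 0 with h | h
    · simp [h]
    · have := Int.one_le_abs h
      nlinarith
  have hR2 : |β| * |z| ^ 2 + |G| * |z| + |k| ≤ R * (|z| ^ 2 + 1) := by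
    rw [hR]; nlinarith [mul_nonneg n4 (sq_nonneg |z|), mul_nonneg n6 (sq_nonneg |z|)]
  rcases le_or_gt |z| (2 * S) with hz | hz
  · have h1 : |x| ≤ |x| * |α * z ^ 2 + E * z + H| := by nlinarith
    have h2 : |z| ^ 2 ≤ (2 * S) ^ 2 := pow_le_pow_left₀ hz0 hz 2
    calc |x| ≤ R * (|z| ^ 2 + 1) := by linarith
      _ ≤ _ := mul_le_mul_of_nonneg_left (by linarith) hRpos
  · have hz1 : 1 ≤ |z| := by linarith
    have hEH : |E * z + H| ≤ (S - 1) * |z| := by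
      have := abs_add_le (E * z) H
      rw [abs_mul] at this
      rw [hS]; nlinarith
    have hP2 : |z| ^ 2 ≤ 2 * |α * z ^ 2 + E * z + H| := by
      have h1 : |α * z ^ 2| ≤ |α * z ^ 2 + E * z + H| + |E * z + H| := by
        have h0 := abs_add_le (α * z ^ 2 + E * z + H) (-(E * z + H))
        rw [abs_neg] at h0
        have h00 : α * z ^ 2 + E * z + H + -(E * z + H) = α * z ^ 2 := by ring
        rwa [h00] at h0
      rw [abs_mul, abs_pow] at h1
      have h2 : |z| ^ 2 ≤ |α| * |z| ^ 2 := by nlinarith [sq_nonneg |z|]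
      nlinarith
    have h3 : |x| * |z| ^ 2 ≤ 2 * (R * (|z| ^ 2 + 1)) := by
      have : |x| * |z| ^ 2 ≤ |x| * (2 * |α * z ^ 2 + E * z + H|) :=
        mul_le_mul_of_nonneg_left hP2 hx0
      linarith
    have h4 : |x| * |z| ^ 2 ≤ (4 * R) * |z| ^ 2 := by nlinarith
    have h5 : |x| ≤ 4 * R := le_of_mul_le_mul_right h4 (by positivity)
    have hS1 : 1 ≤ S := by linarith
    nlinarith [mul_le_mul hS1 hS1 (by norm_num) (by linarith)]

theorem finite_x {a b c03 α β γ e g δ f h k M : ℤ} (ha : a ≠ 0)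
    (hb : ∀ x y : ℤ, -M ≤ (a * x + b) * cub c03 α β γ e g δ f h k x y) (d : ℤ) (hd : d ≠ 0) :
    {x : ℤ | ∃ y : ℤ, cub c03 α β γ e g δ f h k x y = d}.Finite := by
  obtain ⟨rfl, hy⟩ := ydir ha hb
  by_cases hα : α = 0
  · subst hα
    have hβ : β = 0 := by
      have : a * β = 0 := aux_lin_zero (E := b * β) (M := 0)
        (fun t => by have := (hy t).1; linarith)
      exact (mul_eq_zero.mp this).resolve_left ha
    subst hβ
    obtain ⟨h1, h2, h3, -⟩ := aux_roots_all (A := a * γ) (B := a * e + b * γ) (D := a * g + b * e)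
      (E := b * g) (fun x => by have := (hy x).2 (by ring); linarith)
    have hγ : γ = 0 := (mul_eq_zero.mp h1).resolve_left ha
    subst hγ
    have he : e = 0 := (mul_eq_zero.mp (show a * e = 0 by linarith)).resolve_left ha
    subst he
    have hg : g = 0 := (mul_eq_zero.mp (show a * g = 0 by linarith)).resolve_left ha
    subst hg
    refine (aux_roots δ f h (k - d) ?_).subset ?_
    · rintro ⟨rfl, rfl, rfl, hk⟩
      have hk' : k = d := by linarith
      subst hk'
      have : a * k = 0 := aux_lin_zero (E := b * k) (M := M)
        (fun t => by have := hb t 0; unfold cub at this; linarith)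
      exact (mul_ne_zero ha hd) this
    · rintro x ⟨y, hxy⟩
      unfold cub at hxy
      simp only [Set.mem_ofPred_eq]
      linarith
  · have haα : 0 < a * α := by
      have : 0 ≤ a * α := aux_quad (D := a * β + b * α) (E := b * β) (M := 0)
        (fun t _ => by have := (hy t).1; linarith)
      exact lt_of_le_of_ne this (mul_ne_zero ha hα).symm
    have hline : ∀ t : ℤ, -M ≤ (a * (2 * α) * (2 * α * (α * γ ^ 2 - 2 * α * γ ^ 2 + 4 * α ^ 2 * δ))) * t ^ 4
        + (b * (2 * α * (α * γ ^ 2 - 2 * α * γ ^ 2 + 4 * α ^ 2 * δ))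
          + a * (2 * α) * (β * γ ^ 2 - 2 * α * γ * e + 4 * α ^ 2 * f)) * t ^ 3
        + (b * (β * γ ^ 2 - 2 * α * γ * e + 4 * α ^ 2 * f) + a * (2 * α) * (2 * α * h - γ * g)) * t ^ 2
        + (b * (2 * α * h - γ * g) + a * (2 * α) * k) * t + b * k := by
      intro t
      have := hb (2 * α * t) (-γ * t)
      unfold cub at this
      linarith
    have hD : 0 ≤ 4 * α * δ - γ ^ 2 := by
      have h1 := aux_quartic (fun t _ => hline t)
      have h2 : 0 ≤ (4 * (a * α) * α ^ 2) * (4 * α * δ - γ ^ 2) := by linarith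
      have h3 : 0 < 4 * (a * α) * α ^ 2 := by positivity
      exact nonneg_of_mul_nonneg_right h2 h3
    have hform : ∀ x y : ℤ, cub 0 α β γ e g δ f h k x y = d →
        α * x * ((2 * α * y + γ * x) ^ 2 + (4 * α * δ - γ ^ 2) * x ^ 2) + β * (2 * α * y + γ * x) ^ 2
        + (2 * α * e - 2 * β * γ) * (x * (2 * α * y + γ * x))
        + (β * γ ^ 2 - 2 * α * γ * e + 4 * α ^ 2 * f) * x ^ 2
        + (2 * α * g) * (2 * α * y + γ * x) + (4 * α ^ 2 * h - 2 * α * g * γ) * x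
        + 4 * α ^ 2 * (k - d) = 0 := by
      intro x y hxy
      rw [← hxy]
      unfold cub
      ring
    rcases hD.lt_or_eq with hD | hD
    · refine finite_of_bound (|β| + |2 * α * e - 2 * β * γ|
        + |β * γ ^ 2 - 2 * α * γ * e + 4 * α ^ 2 * f| + |2 * α * g|
        + |4 * α ^ 2 * h - 2 * α * g * γ| + |4 * α ^ 2 * (k - d)|) ?_
      rintro x ⟨y, hxy⟩
      exact bound_definite hα hD (hform x y hxy)
    · have hΦ : β * γ ^ 2 - 2 * α * γ * e + 4 * α ^ 2 * f = 0 := by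
        have hq : α * γ ^ 2 - 2 * α * γ ^ 2 + 4 * α ^ 2 * δ = 0 := by
          have : α * (4 * α * δ - γ ^ 2) = 0 := by rw [← hD, mul_zero]
          linarith
        rw [hq] at hline
        have h1 := aux_cubic_zero (B := a * (2 * α) * (β * γ ^ 2 - 2 * α * γ * e + 4 * α ^ 2 * f))
          (fun t => by have := hline t; simp only [mul_zero, zero_mul, zero_add] at this; exact this)
        refine (mul_eq_zero.mp h1).resolve_left ?_
        exact mul_ne_zero ha (mul_ne_zero two_ne_zero hα)
      obtain ⟨B, hB⟩ := bound_degenerate α β (2 * α * e - 2 * β * γ) (2 * α * g)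
        (4 * α ^ 2 * h - 2 * α * g * γ) (4 * α ^ 2 * (k - d)) hα
      refine finite_of_bound B ?_
      rintro x ⟨y, hxy⟩
      have hf := hform x y hxy
      rw [← hD, hΦ] at hf
      refine hB x (2 * α * y + γ * x) ?_ (by linarith)
      intro hP
      -- the whole line through `(x, y)` maps to `d`
      have hK : ∀ t : ℤ, cub 0 α β γ e g δ f h k (x + 2 * α * t) (y - γ * t) = d := by
        intro t
        have h4 : 4 * α ^ 2 * (cub 0 α β γ e g δ f h k (x + 2 * α * t) (y - γ * t) - d) =
          (4 * α ^ 2 * (cub 0 α β γ e g δ f h k x y - d)) +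
          2 * α * t * (α * (2 * α * y + γ * x) ^ 2 +
            (2 * α * e - 2 * β * γ) * (2 * α * y + γ * x) + (4 * α ^ 2 * h - 2 * α * g * γ))
          + α * (4 * α * δ - γ ^ 2) * ((x + 2 * α * t) ^ 3 - x ^ 3)
          + (β * γ ^ 2 - 2 * α * γ * e + 4 * α ^ 2 * f) * ((x + 2 * α * t) ^ 2 - x ^ 2) := by
          unfold cub
          ring
        rw [hP, hΦ, ← hD, hxy] at h4
        have h5 : 4 * α ^ 2 * (cub 0 α β γ e g δ f h k (x + 2 * α * t) (y - γ * t) - d) = 0 := by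
          rw [h4]; ring
        have h6 := (mul_eq_zero.mp h5).resolve_left (by positivity)
        linarith
      have : a * (2 * α) * d = 0 := aux_lin_zero (E := (a * x + b) * d) (M := M) (fun t => by
        have := hb (x + 2 * α * t) (y - γ * t)
        rw [hK] at this
        linarith)
      exact mul_ne_zero (mul_ne_zero ha (mul_ne_zero two_ne_zero hα)) hd this

/-- Values on a vertical line. -/
theorem count_quad (p q r : ℤ) (hp : 0 ≤ p) (hpq : p = 0 → q = 0) :
    ∃ c : ℝ, 0 ≤ c ∧ ∀ N : ℕ, 1 ≤ N →
      {m : ℤ | m ≤ (N : ℤ) ∧ ∃ y : ℤ, p * y ^ 2 + q * y + r = m}.Finite ∧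
      ({m : ℤ | m ≤ (N : ℤ) ∧ ∃ y : ℤ, p * y ^ 2 + q * y + r = m}.ncard : ℝ)
        ≤ c * Real.sqrt N := by
  have hsq : ∀ N : ℕ, 1 ≤ N → (1 : ℝ) ≤ Real.sqrt N := fun N hN =>
    Real.one_le_sqrt.mpr (by exact_mod_cast hN)
  rcases hp.eq_or_lt with h0 | hp
  · have hq := hpq h0.symm
    refine ⟨1, zero_le_one, fun N hN => ?_⟩
    have hsub : {m : ℤ | m ≤ (N : ℤ) ∧ ∃ y : ℤ, p * y ^ 2 + q * y + r = m} ⊆ {r} := by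
      rintro m ⟨-, y, hy⟩
      rw [← h0, hq] at hy
      simp only [Set.mem_singleton_iff]
      linarith
    refine ⟨(Set.finite_singleton r).subset hsub, ?_⟩
    have h1 := Set.ncard_le_ncard hsub (Set.finite_singleton r)
    rw [Set.ncard_singleton] at h1
    have h2 : ({m : ℤ | m ≤ (N : ℤ) ∧ ∃ y : ℤ, p * y ^ 2 + q * y + r = m}.ncard : ℝ) ≤ 1 := by
      exact_mod_cast h1
    linarith [hsq N hN]
  · have nq := abs_nonneg q
    have nr := abs_nonneg r
    obtain ⟨B, hB⟩ : ∃ B : ℕ, (B : ℤ) = 2 * (|q| + |r| + 1) :=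
      ⟨(2 * (|q| + |r| + 1)).toNat, Int.toNat_of_nonneg (by positivity)⟩
    refine ⟨2 * (2 * (B + 2)) + 1, by positivity, fun N hN => ?_⟩
    obtain ⟨L, hL⟩ : ∃ L : ℕ, L = B + 2 * (Nat.sqrt N + 1) := ⟨_, rfl⟩
    have hsub : {m : ℤ | m ≤ (N : ℤ) ∧ ∃ y : ℤ, p * y ^ 2 + q * y + r = m} ⊆
        ((Finset.Icc (-(L : ℤ)) L).image (fun y => p * y ^ 2 + q * y + r) : Finset ℤ) := by
      rintro m ⟨hm, y, hy⟩
      simp only [Finset.coe_image, Set.mem_image, Finset.coe_Icc, Set.mem_Icc]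
      refine ⟨y, abs_le.mp ?_, hy⟩
      by_contra hlt
      push Not at hlt
      have hs : (N : ℤ) < ((Nat.sqrt N : ℤ) + 1) ^ 2 := by
        have := Nat.lt_succ_sqrt N
        have h2 : (N : ℤ) < ((Nat.sqrt N).succ * (Nat.sqrt N).succ : ℕ) := by exact_mod_cast this
        push_cast at h2
        nlinarith
      have hy2 : |y| ^ 2 = y ^ 2 := sq_abs y
      have hs0 : (0 : ℤ) ≤ Nat.sqrt N := by positivity
      have hLz : (L : ℤ) = B + 2 * ((Nat.sqrt N : ℤ) + 1) := by rw [hL]; push_cast; ring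
      have hyB : 2 * (|q| + |r| + 1) ≤ |y| := by linarith
      have hyS : 2 * ((Nat.sqrt N : ℤ) + 1) ≤ |y| := by linarith
      have h4N : 4 * (N : ℤ) < |y| ^ 2 := by nlinarith
      have hqy : -(|q| * |y|) ≤ q * y := by rw [← abs_mul]; exact neg_abs_le _
      have hr : -|r| ≤ r := neg_abs_le r
      have hpy : |y| ^ 2 ≤ p * y ^ 2 := by rw [hy2]; nlinarith [sq_nonneg y]
      nlinarith
    have hfin := Finset.finite_toSet
      ((Finset.Icc (-(L : ℤ)) L).image (fun y => p * y ^ 2 + q * y + r))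
    refine ⟨hfin.subset hsub, ?_⟩
    have h1 := Set.ncard_le_ncard hsub hfin
    rw [Set.ncard_coe_finset] at h1
    have h2 := h1.trans Finset.card_image_le
    have h3 : (Finset.Icc (-(L : ℤ)) L).card = 2 * L + 1 := by
      rw [Int.card_Icc]; omega
    rw [h3, hL] at h2
    have h4 : ({m : ℤ | m ≤ (N : ℤ) ∧ ∃ y : ℤ, p * y ^ 2 + q * y + r = m}.ncard : ℝ)
        ≤ 2 * (B + 2 * ((Nat.sqrt N : ℝ) + 1)) + 1 := by exact_mod_cast h2
    have h5 : (Nat.sqrt N : ℝ) ≤ Real.sqrt N := Real.nat_sqrt_le_real_sqrt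
    have h6 := hsq N hN
    have h7 : (0 : ℝ) ≤ B := by positivity
    nlinarith

theorem count_main {a b c03 α β γ e g δ f h k M : ℤ} (ha : a ≠ 0)
    (hb : ∀ x y : ℤ, -M ≤ (a * x + b) * cub c03 α β γ e g δ f h k x y) (C : ℤ) (hC : 0 < C) :
    ∃ c : ℝ, 0 < c ∧ ∀ N : ℕ, 1 ≤ N →
      ({m : ℤ | 1 ≤ m ∧ m ≤ (N : ℤ) ∧ (∃ p : ℕ, p.Prime ∧ m = C * p) ∧
        ∃ x y : ℤ, (a * x + b) * cub c03 α β γ e g δ f h k x y = m}.ncard : ℝ)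
        ≤ c * Real.sqrt N := by
  have hdiv : {w : ℤ | w ∣ C}.Finite := by
    refine finite_of_bound C fun w hw => ?_
    have := Int.le_of_dvd hC ((abs_dvd w C).mpr hw)
    exact this
  -- the finitely many `x` with `a x + b ∣ C`
  have hX : {x : ℤ | (a * x + b) ∣ C}.Finite := by
    refine Set.Finite.preimage (f := fun x => a * x + b) ?_ hdiv
    intro x _ y _ hxy
    have : a * x = a * y := by simpa using hxy
    exact mul_left_cancel₀ ha this
  -- the finitely many values coming from `K(x, y) ∣ C`
  have hT : (⋃ d ∈ {w : ℤ | w ∣ C}, (fun x => (a * x + b) * d) ''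
      {x : ℤ | ∃ y : ℤ, cub c03 α β γ e g δ f h k x y = d}).Finite := by
    refine Set.Finite.biUnion hdiv fun d hd => Set.Finite.image _ (finite_x ha hb d ?_)
    rintro rfl
    exact hC.ne' (zero_dvd_iff.mp hd)
  obtain ⟨T, hTdef⟩ : ∃ T : Set ℤ, T = (⋃ d ∈ {w : ℤ | w ∣ C}, (fun x => (a * x + b) * d) ''
      {x : ℤ | ∃ y : ℤ, cub c03 α β γ e g δ f h k x y = d}) := ⟨_, rfl⟩
  rw [← hTdef] at hT
  obtain ⟨hc03, hy⟩ := ydir ha hb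
  choose cx hcx0 hcx using fun x : ℤ => count_quad ((a * x + b) * (α * x + β))
    ((a * x + b) * (γ * x ^ 2 + e * x + g))
    ((a * x + b) * (δ * x ^ 3 + f * x ^ 2 + h * x + k)) (hy x).1 (hy x).2
  refine ⟨T.ncard + ∑ x ∈ hX.toFinset, cx x + 1, ?_, fun N hN => ?_⟩
  · have : 0 ≤ ∑ x ∈ hX.toFinset, cx x := Finset.sum_nonneg fun x _ => hcx0 x
    positivity
  obtain ⟨V, hV⟩ : ∃ V : ℤ → Set ℤ, ∀ x, V x = {m : ℤ | m ≤ (N : ℤ) ∧ ∃ y : ℤ,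
    (a * x + b) * (α * x + β) * y ^ 2 + (a * x + b) * (γ * x ^ 2 + e * x + g) * y
      + (a * x + b) * (δ * x ^ 3 + f * x ^ 2 + h * x + k) = m} := ⟨_, fun _ => rfl⟩
  have hVfin : ∀ x, (V x).Finite := fun x => by rw [hV]; exact (hcx x N hN).1
  have hVc : ∀ x, ((V x).ncard : ℝ) ≤ cx x * Real.sqrt N := fun x => by
    rw [hV]; exact (hcx x N hN).2
  have hsub : {m : ℤ | 1 ≤ m ∧ m ≤ (N : ℤ) ∧ (∃ p : ℕ, p.Prime ∧ m = C * p) ∧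
        ∃ x y : ℤ, (a * x + b) * cub c03 α β γ e g δ f h k x y = m} ⊆
      T ∪ ⋃ x ∈ hX.toFinset, V x := by
    rintro m ⟨hm1, hmN, ⟨p, hp, hmp⟩, x, y, hxy⟩
    have hpZ : Prime (p : ℤ) := Nat.prime_iff_prime_int.mp hp
    by_cases hdvd : (p : ℤ) ∣ a * x + b
    · left
      obtain ⟨w, hw⟩ := hdvd
      rw [hTdef]
      simp only [Set.mem_iUnion, Set.mem_image, Set.mem_ofPred_eq]
      refine ⟨cub c03 α β γ e g δ f h k x y, ⟨w, ?_⟩, x, ⟨y, rfl⟩, hxy⟩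
      have h1 : (p : ℤ) * C = p * (cub c03 α β γ e g δ f h k x y * w) := by
        calc (p : ℤ) * C = m := by rw [hmp]; ring
          _ = _ := by rw [← hxy, hw]; ring
      exact mul_left_cancel₀ hpZ.ne_zero h1
    · right
      have hcop : IsCoprime (a * x + b) (p : ℤ) := ((hpZ.coprime_iff_not_dvd).mpr hdvd).symm
      have h1 : (a * x + b) ∣ C * p := ⟨_, by rw [← hmp, ← hxy]⟩
      have h2 := hcop.dvd_of_dvd_mul_right h1
      simp only [Set.mem_iUnion, Set.Finite.mem_toFinset, Set.mem_ofPred_eq]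
      refine ⟨x, h2, ?_⟩
      rw [hV]
      refine ⟨hmN, y, ?_⟩
      rw [← hxy, hc03]
      unfold cub
      ring
  have hUfin : (⋃ x ∈ hX.toFinset, V x).Finite :=
    Set.Finite.biUnion (Finset.finite_toSet _) fun x _ => hVfin x
  have h1 := Set.ncard_le_ncard hsub (hT.union hUfin)
  have h2 := Set.ncard_union_le T (⋃ x ∈ hX.toFinset, V x)
  have h3 := Finset.set_ncard_biUnion_le hX.toFinset V
  have h4 := h1.trans (h2.trans (Nat.add_le_add_left h3 _))
  have h5 : ({m : ℤ | 1 ≤ m ∧ m ≤ (N : ℤ) ∧ (∃ p : ℕ, p.Prime ∧ m = C * p) ∧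
        ∃ x y : ℤ, (a * x + b) * cub c03 α β γ e g δ f h k x y = m}.ncard : ℝ) ≤
      T.ncard + ∑ x ∈ hX.toFinset, ((V x).ncard : ℝ) := by exact_mod_cast h4
  have h6 : ∑ x ∈ hX.toFinset, ((V x).ncard : ℝ) ≤ (∑ x ∈ hX.toFinset, cx x) * Real.sqrt N := by
    rw [Finset.sum_mul]
    exact Finset.sum_le_sum fun x _ => hVc x
  have h7 : (1 : ℝ) ≤ Real.sqrt N := Real.one_le_sqrt.mpr (by exact_mod_cast hN)
  have h8 : (0 : ℝ) ≤ (T.ncard : ℝ) := by positivity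
  nlinarith

/-- **Lemma 6.8.** Suppose `F ∈ ℤ[x,y]` has degree 4, `F(0,0) = 0`,
the degree-4 part `F₄` is positive semi-definite and `gcd(F̃₄, F₃, F₂, F₁)` has degree
1 or 3, so that after a `GL₂(ℤ)`-change of variables `F(x,y) = (ax + b)·K(x,y)` with
`a ∈ ℤ \ {0}`, `b ∈ ℤ` and `K` a degree-3 primitive integral polynomial.  Then for every
`C ∈ ℕ`, either `#(F(ℤ²) ∩ C℘ ∩ [1,N]) ≪ √N · log N`, or
`inf_{(x,y) ∈ ℤ²} F(x,y) = -∞`. -/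
theorem gcd_degree_one_or_three_prime_values
    (F : MvPolynomial (Fin 2) ℤ) (hdeg : F.totalDegree = 4)
    (h0 : MvPolynomial.eval ![0, 0] F = 0)
    (hpsd : PosSemidef2 (MvPolynomial.homogeneousComponent 4 F))
    (Ft4 : MvPolynomial (Fin 2) ℤ)
    (htilde : IsTildePart (MvPolynomial.homogeneousComponent 4 F) Ft4)
    (hgcd : ∃ g : MvPolynomial (Fin 2) ℚ, (g.totalDegree = 1 ∨ g.totalDegree = 3) ∧
      g ∣ toQ Ft4 ∧ g ∣ toQ (MvPolynomial.homogeneousComponent 3 F) ∧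
      g ∣ toQ (MvPolynomial.homogeneousComponent 2 F) ∧
      g ∣ toQ (MvPolynomial.homogeneousComponent 1 F) ∧
      ∀ e : MvPolynomial (Fin 2) ℚ, e ∣ toQ Ft4 →
        e ∣ toQ (MvPolynomial.homogeneousComponent 3 F) →
        e ∣ toQ (MvPolynomial.homogeneousComponent 2 F) →
        e ∣ toQ (MvPolynomial.homogeneousComponent 1 F) → e ∣ g)
    (hfac : ∃ (A : Matrix (Fin 2) (Fin 2) ℤ) (a b : ℤ) (K : MvPolynomial (Fin 2) ℤ),
      IsUnit A.det ∧ a ≠ 0 ∧ K.totalDegree = 3 ∧ IsPrimitiveInt K ∧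
      MvPolynomial.bind₁
          (fun i => MvPolynomial.C (A i 0) * MvPolynomial.X 0 +
            MvPolynomial.C (A i 1) * MvPolynomial.X 1) F
        = (MvPolynomial.C a * MvPolynomial.X 0 + MvPolynomial.C b) * K)
    (C : ℤ) (hC : 0 < C) :
    (∃ c : ℝ, 0 < c ∧ ∀ᶠ N : ℕ in Filter.atTop,
      ({m : ℤ | 1 ≤ m ∧ m ≤ (N : ℤ) ∧ (∃ p : ℕ, p.Prime ∧ m = C * p) ∧
          m ∈ valueSet F}.ncard : ℝ)
        ≤ c * Real.sqrt N * Real.log N) ∨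
    (∀ M : ℤ, ∃ x y : ℤ, MvPolynomial.eval ![x, y] F < -M) := by
  by_cases hbelow : ∀ M : ℤ, ∃ x y : ℤ, MvPolynomial.eval ![x, y] F < -M
  · exact Or.inr hbelow
  left
  push Not at hbelow
  obtain ⟨M, hM⟩ := hbelow
  obtain ⟨A, a, b, K, hA, ha, hK, -, hF⟩ := hfac
  obtain ⟨c03, α, β, γ, e, g, δ, f, h, k, hcub⟩ := cub_of_totalDegree K hK.le
  have hval : ∀ x y : ℤ, MvPolynomial.eval ![A 0 0 * x + A 0 1 * y, A 1 0 * x + A 1 1 * y] F =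
      (a * x + b) * cub c03 α β γ e g δ f h k x y := by
    intro x y
    have h1 := congrArg (MvPolynomial.eval ![x, y]) hF
    rw [map_mul, hcub] at h1
    simp only [map_add, map_mul, MvPolynomial.eval_C, MvPolynomial.eval_X,
      Matrix.cons_val_zero] at h1
    rw [← h1, ← MvPolynomial.aeval_eq_eval, ← MvPolynomial.aeval_eq_eval,
      MvPolynomial.aeval_bind₁]
    congr 2
    funext i
    fin_cases i <;> simp
  obtain ⟨c, hc0, hc⟩ := count_main (M := M) ha
    (fun x y => by rw [← hval]; exact hM _ _) C hC
  refine ⟨c, hc0, ?_⟩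
  filter_upwards [Filter.eventually_ge_atTop 3] with N hN
  have hset : {m : ℤ | 1 ≤ m ∧ m ≤ (N : ℤ) ∧ (∃ p : ℕ, p.Prime ∧ m = C * p) ∧
      m ∈ valueSet F} = {m : ℤ | 1 ≤ m ∧ m ≤ (N : ℤ) ∧ (∃ p : ℕ, p.Prime ∧ m = C * p) ∧
        ∃ x y : ℤ, (a * x + b) * cub c03 α β γ e g δ f h k x y = m} := by
    ext m
    simp only [Set.mem_ofPred_eq, valueSet]
    refine and_congr_right fun _ => and_congr_right fun _ => and_congr_right fun _ => ?_
    constructor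
    · rintro ⟨x, y, hxy⟩
      rw [Matrix.det_fin_two] at hA
      obtain ⟨u, hu⟩ := hA.exists_left_inv
      refine ⟨u * (A 1 1 * x - A 0 1 * y), u * (A 0 0 * y - A 1 0 * x), ?_⟩
      rw [← hval, ← hxy]
      congr 3
      · linear_combination x * hu
      · congr 1
        linear_combination y * hu
    · rintro ⟨x, y, hxy⟩
      exact ⟨_, _, (hval x y).trans hxy⟩
  rw [hset]
  refine (hc N (by omega)).trans ?_
  have hlog : 1 ≤ Real.log N := by
    rw [Real.le_log_iff_exp_le (by positivity)]
    have h1 : Real.exp 1 < 3 := Real.exp_one_lt_three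
    have h2 : (3 : ℝ) ≤ N := by exact_mod_cast hN
    linarith
  exact le_mul_of_one_le_right (by positivity) hlog
end
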